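/- arXiv:1605.04234 — 2 statements merged into one kernel-verified Lean document; each statement's English description precedes it below -/
import Mathlib

section
/- Let Λ₁, Λ₂: ℝ → ℝ be real analytic, positive, 1-periodic functions. Then there exists ε > 0 and real analytic functions Λ, u₀, f, g: ℝ² × (−ε, ε) → ℝ, doubly periodic in (x,y) for each t, that satisfy system (11) on ℝ² × (−ε, ε) together with the Liouville initial data at t = 0; moreover this solution is unique: any two real analytic solutions of this Cauchy problem agree on a neighborhood of the plane {t = 0}. -/
open Set

/-- Partial derivative in `x`. -/
noncomputable def pX (h : ℝ × ℝ × ℝ → ℝ) (p : ℝ × ℝ × ℝ) : ℝ := fderiv ℝ h p (1, 0, 0)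

/-- Partial derivative in `y`. -/
noncomputable def pY (h : ℝ × ℝ × ℝ → ℝ) (p : ℝ × ℝ × ℝ) : ℝ := fderiv ℝ h p (0, 1, 0)

/-- Partial derivative in `t`. -/
noncomputable def pT (h : ℝ × ℝ × ℝ → ℝ) (p : ℝ × ℝ × ℝ) : ℝ := fderiv ℝ h p (0, 0, 1)

/-- The strip `ℝ² × (-ε, ε)` in coordinates `(x, y, t)`. -/
def Strip (ε : ℝ) : Set (ℝ × ℝ × ℝ) := {p : ℝ × ℝ × ℝ | p.2.2 ∈ Ioo (-ε) ε}

/-- `h` is doubly periodic in `(x,y)` on the strip `ℝ² × (-ε,ε)`. -/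
def DoublyPeriodicOn (ε : ℝ) (h : ℝ × ℝ × ℝ → ℝ) : Prop :=
  ∀ x y t : ℝ, t ∈ Ioo (-ε) ε →
    h (x + 1, y, t) = h (x, y, t) ∧ h (x, y + 1, t) = h (x, y, t)

/-- System (11) of the paper holds at the point `p`. -/
def System11At (Λ u₀ f g : ℝ × ℝ × ℝ → ℝ) (p : ℝ × ℝ × ℝ) : Prop :=
  pT Λ p = g p * pX Λ p + Λ p * pX g p + f p * pY Λ p + Λ p * pY f p ∧
  pT u₀ p = -2 * g p * pX Λ p + g p * pX u₀ p - 2 * Λ p * pX g p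
      + 2 * f p * pY Λ p + f p * pY u₀ p + 2 * Λ p * pY f p ∧
  pT f p = 2 * pY u₀ p ∧
  pT g p = -2 * pX u₀ p

/-- `Λ, u₀, f, g` is a real analytic, doubly periodic in `(x,y)`, solution of the Cauchy
problem for system (11) with Liouville initial data `Λ = Λ₁(x) + Λ₂(y)`,
`u₀ = 2Λ₂(y) - 2Λ₁(x)`, `f = g = 0` at `t = 0`, on the strip `ℝ² × (-ε, ε)`. -/
def IsCauchySolution (Λ₁ Λ₂ : ℝ → ℝ) (ε : ℝ) (Λ u₀ f g : ℝ × ℝ × ℝ → ℝ) : Prop :=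
  AnalyticOnNhd ℝ Λ (Strip ε) ∧ AnalyticOnNhd ℝ u₀ (Strip ε) ∧
  AnalyticOnNhd ℝ f (Strip ε) ∧ AnalyticOnNhd ℝ g (Strip ε) ∧
  DoublyPeriodicOn ε Λ ∧ DoublyPeriodicOn ε u₀ ∧
  DoublyPeriodicOn ε f ∧ DoublyPeriodicOn ε g ∧
  (∀ p ∈ Strip ε, System11At Λ u₀ f g p) ∧
  (∀ x y : ℝ, Λ (x, y, 0) = Λ₁ x + Λ₂ y ∧ u₀ (x, y, 0) = 2 * Λ₂ y - 2 * Λ₁ x ∧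
    f (x, y, 0) = 0 ∧ g (x, y, 0) = 0)

section Preliminaries

open scoped Nat NNReal ENNReal ContDiff Topology

section AnalyticBounds

variable {E V : Type*} [NormedAddCommGroup E] [NormedSpace ℝ E]
  [NormedAddCommGroup V] [NormedSpace ℝ V] [CompleteSpace V]

/-- An analytic function satisfies locally uniform Cauchy estimates. -/
theorem AnalyticAt.exists_iteratedFDeriv_bound {f : E → V} {x₀ : E} (hf : AnalyticAt ℝ f x₀) :
    ∃ C R : ℝ, ∀ᶠ y in 𝓝 x₀, ∀ k : ℕ, ‖iteratedFDeriv ℝ k f y‖ ≤ C * R ^ k * k ! := by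
  obtain ⟨p, r, hp⟩ := hf
  obtain ⟨s, hs0, hs⟩ : ∃ s : ℝ≥0, 0 < s ∧ ((s + s : ℝ≥0) : ℝ≥0∞) < r := by
    obtain ⟨q, hq0, hq⟩ := ENNReal.lt_iff_exists_nnreal_btwn.1 hp.r_pos
    refine ⟨q / 2, by simpa using hq0, by simpa using hq⟩
  have hsr : (s : ℝ≥0∞) < r := lt_of_le_of_lt (by exact_mod_cast le_add_self) hs
  have hsum := p.changeOriginSeries_summable_aux₁ (r := s) (r' := s)
    (lt_of_lt_of_le (by exact_mod_cast hs) hp.r_le)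
  set F := fun z : Σ k l : ℕ, { t : Finset (Fin (k + l)) // t.card = l } =>
      ‖p (z.1 + z.2.1)‖₊ * s ^ z.2.1 * s ^ z.1 with hF
  have key : ∀ z : E, ‖z‖₊ ≤ s → ∀ k, ‖p.changeOrigin z k‖₊ * s ^ k ≤ ∑' z, F z := by
    intro z hz k
    have h1 : ‖p.changeOrigin z k‖₊ ≤ _ := p.nnnorm_changeOrigin_le k
      (lt_of_lt_of_le (lt_of_le_of_lt (by exact_mod_cast hz) hsr) hp.r_le)
    have hsr' : (s : ℝ≥0∞) < p.radius := lt_of_lt_of_le hsr hp.r_le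
    have h2 := p.changeOriginSeries_summable_aux₂ hsr' k
    have h3 : ‖p.changeOrigin z k‖₊ ≤
        ∑' t : Σ l : ℕ, { t : Finset (Fin (k + l)) // t.card = l }, ‖p (k + t.1)‖₊ * s ^ t.1 := by
      refine h1.trans (Summable.tsum_le_tsum (fun t => by gcongr) ?_ h2)
      exact NNReal.summable_of_le (fun t => by gcongr) h2
    calc ‖p.changeOrigin z k‖₊ * s ^ k
        ≤ (∑' t : Σ l : ℕ, { t : Finset (Fin (k + l)) // t.card = l },
            ‖p (k + t.1)‖₊ * s ^ t.1) * s ^ k := by gcongr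
      _ = ∑' t : Σ l : ℕ, { t : Finset (Fin (k + l)) // t.card = l }, F ⟨k, t⟩ := by
          rw [← NNReal.tsum_mul_right]
      _ ≤ ∑' z, F z := NNReal.tsum_comp_le_tsum_of_inj hsum sigma_mk_injective
  refine ⟨(∑' z, F z : ℝ≥0), (s : ℝ)⁻¹, ?_⟩
  filter_upwards [Metric.closedBall_mem_nhds x₀ (by exact_mod_cast hs0 : (0 : ℝ) < s)] with y hy k
  have hz : ‖y - x₀‖₊ ≤ s := by
    rw [← NNReal.coe_le_coe, coe_nnnorm, ← dist_eq_norm]; exact hy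
  have hb := hp.changeOrigin (y := y - x₀) (lt_of_le_of_lt (by exact_mod_cast hz) hsr)
  rw [add_sub_cancel] at hb
  have hk : ‖p.changeOrigin (y - x₀) k‖ ≤ (∑' z, F z : ℝ≥0) * (s : ℝ)⁻¹ ^ k := by
    have := key _ hz k
    rw [inv_pow, ← div_eq_mul_inv, le_div_iff₀ (by positivity)]
    exact_mod_cast this
  refine ContinuousMultilinearMap.opNorm_le_bound (by positivity) fun v => ?_
  rw [hb.iteratedFDeriv_eq_sum_of_completeSpace]
  refine (norm_sum_le _ _).trans ?_
  have : ∀ σ ∈ (Finset.univ : Finset (Equiv.Perm (Fin k))),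
      ‖p.changeOrigin (y - x₀) k fun i => v (σ i)‖ ≤
        ((∑' z, F z : ℝ≥0) * (s : ℝ)⁻¹ ^ k) * ∏ i, ‖v i‖ := by
    intro σ _
    refine (ContinuousMultilinearMap.le_opNorm _ _).trans ?_
    rw [Equiv.prod_comp σ fun i => ‖v i‖]
    gcongr
  refine (Finset.sum_le_sum this).trans (le_of_eq ?_)
  simp only [Finset.sum_const, Finset.card_univ, Fintype.card_perm, Fintype.card_fin, nsmul_eq_mul]
  ring

/-- The Taylor series of an everywhere analytic function sums to it wherever the series converges
absolutely. -/
theorem hasFPowerSeriesOnBall_taylor {w : E → V} (hw : AnalyticOnNhd ℝ w univ) (x₀ : E)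
    {r : ℝ≥0} (hr : 0 < r) {q : FormalMultilinearSeries ℝ E V}
    (hq : ∀ k, q k = (k ! : ℝ)⁻¹ • iteratedFDeriv ℝ k w x₀)
    (hsum : Summable fun k => ‖q k‖ * (r : ℝ) ^ k) :
    HasFPowerSeriesOnBall w q x₀ r := by
  have hrad : (r : ℝ≥0∞) ≤ q.radius := q.le_radius_of_summable_norm hsum
  have hr' : (0 : ℝ≥0∞) < r := by exact_mod_cast hr
  have hs := (q.hasFPowerSeriesOnBall (hr'.trans_le hrad)).mono hr' hrad
  have hEq : EqOn q.sum (fun h => w (x₀ + h)) (Metric.eball 0 r) := by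
    refine hs.analyticOnNhd.eqOn_of_preconnected_of_eventuallyEq (z₀ := 0) ?_ ?_
      (Metric.mem_eball_self hr') ?_
    · intro z _
      exact AnalyticAt.fun_comp (hw _ (mem_univ _)) (by fun_prop)
    · rw [Metric.eball_coe]
      exact (convex_ball _ _).isPreconnected
    · obtain ⟨p, s, hp⟩ := hw x₀ (mem_univ _)
      filter_upwards [Metric.eball_mem_nhds (0 : E) hp.r_pos, Metric.eball_mem_nhds (0 : E) hr']
        with z hz hz'
      have h1 := hp.hasSum_iteratedFDeriv hz
      have h2 := hs.hasSum hz'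
      simp only [hq, zero_add, smul_apply] at h2
      exact h2.unique h1
  refine ⟨hrad, hr', fun {y} hy => ?_⟩
  have := hs.hasSum hy
  rw [zero_add, hEq hy] at this
  exact this

/-- A series of everywhere analytic functions whose Taylor series at a point converge absolutely
and uniformly is analytic on a ball. -/
theorem hasFPowerSeriesOnBall_tsum {w : ℕ → E → V} (hw : ∀ n, AnalyticOnNhd ℝ (w n) univ) (x₀ : E)
    {r : ℝ≥0} (hr : 0 < r) {b : ℕ × ℕ → ℝ}
    (hb : ∀ n k, (k ! : ℝ)⁻¹ * ‖iteratedFDeriv ℝ k (w n) x₀‖ * (r : ℝ) ^ k ≤ b (n, k))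
    (hsum : Summable b) :
    ∃ q : FormalMultilinearSeries ℝ E V,
      HasFPowerSeriesOnBall (fun x => ∑' n, w n x) q x₀ r := by
  have hr' : (0 : ℝ≥0∞) < r := by exact_mod_cast hr
  set Q : ℕ → FormalMultilinearSeries ℝ E V :=
    fun n k => (k ! : ℝ)⁻¹ • iteratedFDeriv ℝ k (w n) x₀ with hQ
  have hnorm : ∀ n k, ‖Q n k‖ * (r : ℝ) ^ k ≤ b (n, k) := by
    intro n k
    refine le_trans (le_of_eq ?_) (hb n k)
    rw [hQ, norm_smul, norm_inv, Real.norm_natCast]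
  have hQs : Summable fun z : ℕ × ℕ => ‖Q z.1 z.2‖ * (r : ℝ) ^ z.2 :=
    Summable.of_nonneg_of_le (fun _ => by positivity) (fun z => hnorm z.1 z.2) hsum
  have hQs' : Summable fun z : ℕ × ℕ => ‖Q z.2 z.1‖ * (r : ℝ) ^ z.1 :=
    (Equiv.prodComm ℕ ℕ).summable_iff.2 hQs
  have hw' : ∀ n, HasFPowerSeriesOnBall (w n) (Q n) x₀ r := fun n =>
    hasFPowerSeriesOnBall_taylor (hw n) x₀ hr (fun k => rfl) (hQs.prod_factor n)
  have hQk : ∀ k, Summable fun n => ‖Q n k‖ := by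
    intro k
    have := hQs'.prod_factor k
    simpa [summable_mul_right_iff (pow_ne_zero k (by positivity : (r : ℝ) ≠ 0))] using this
  refine ⟨fun k => ∑' n, Q n k, ?_, hr', ?_⟩
  · refine FormalMultilinearSeries.le_radius_of_summable_norm _ ?_
    refine Summable.of_nonneg_of_le (fun _ => by positivity) (fun k => ?_) hQs'.prod
    change _ ≤ ∑' n, ‖Q n k‖ * (r : ℝ) ^ k
    rw [tsum_mul_right]
    gcongr
    exact norm_tsum_le_tsum_norm (hQk k)
  · intro y hy
    have hy' : ‖y‖ < r := by
      have := mem_eball_zero_iff.1 hy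
      rw [enorm_eq_nnnorm] at this
      exact_mod_cast this
    have hS : Summable fun z : ℕ × ℕ => Q z.2 z.1 fun _ => y := by
      refine Summable.of_norm_bounded hQs' fun z => ?_
      refine ((Q z.2 z.1).le_opNorm _).trans ?_
      rw [Finset.prod_const, Finset.card_univ, Fintype.card_fin]
      gcongr
    have h1 : HasSum (fun k => ∑' n, Q n k fun _ => y) (∑' z : ℕ × ℕ, Q z.2 z.1 fun _ => y) :=
      hS.hasSum.prod_fiberwise fun k => (hS.prod_factor k).hasSum
    have h2 : HasSum (fun n => w n (x₀ + y)) (∑' z : ℕ × ℕ, Q z.2 z.1 fun _ => y) := by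
      have h3 := (Equiv.prodComm ℕ ℕ).hasSum_iff.2 hS.hasSum
      exact h3.prod_fiberwise fun n => (hw' n).hasSum hy
    rw [h2.tsum_eq]
    convert h1 using 2 with k
    exact ((hQk k).of_norm.hasSum.mapL
      (ContinuousMultilinearMap.apply ℝ (fun _ : Fin k => E) V fun _ => y)).tsum_eq.symm

end AnalyticBounds

/-- The Vandermonde convolution identity for rising factorials. -/
theorem Nat.sum_choose_mul_ascFactorial (a b k : ℕ) :
    ∑ i ∈ Finset.range (k + 1), k.choose i * a.ascFactorial i * b.ascFactorial (k - i) =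
      (a + b).ascFactorial k := by
  rw [← Finset.Nat.sum_antidiagonal_eq_sum_range_succ
    (fun i j => k.choose i * a.ascFactorial i * b.ascFactorial j)]
  induction k with
  | zero => simp
  | succ k ih =>
    simp only [mul_assoc] at ih ⊢
    have h := Finset.sum_antidiagonal_choose_succ_nsmul
      (fun i j => a.ascFactorial i * b.ascFactorial j) k
    simp only [smul_eq_mul] at h
    rw [h, Nat.ascFactorial_succ, ← ih, Finset.mul_sum, ← Finset.sum_add_distrib]
    refine Finset.sum_congr rfl fun ij hij => ?_
    rw [Finset.HasAntidiagonal.mem_antidiagonal] at hij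
    rw [Nat.ascFactorial_succ, Nat.ascFactorial_succ, ← hij,
      Nat.choose_symm_add]
    ring

/-- `m (m + 1)_k = (m)_{k + 1}`. -/
theorem Nat.mul_ascFactorial_succ (m k : ℕ) :
    m * (m + 1).ascFactorial k = m.ascFactorial (k + 1) := by
  rw [Nat.ascFactorial_succ, ← Nat.succ_ascFactorial]

theorem Nat.ascFactorial_le_two_pow_mul_factorial (n k : ℕ) :
    (2 * n + 1).ascFactorial k ≤ 4 ^ n * 2 ^ k * k ! := by
  rw [Nat.ascFactorial_eq_factorial_mul_choose, mul_comm]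
  gcongr
  calc (2 * n + k).choose k ≤ 2 ^ (2 * n + k) := Nat.choose_le_two_pow _ _
    _ = 4 ^ n * 2 ^ k := by rw [pow_add, pow_mul]; norm_num

theorem catalan_le_four_pow (n : ℕ) : catalan n ≤ 4 ^ n := by
  rw [catalan_eq_centralBinom_div]
  refine (Nat.div_le_self _ _).trans ?_
  rw [Nat.centralBinom_eq_two_mul_choose]
  refine (Nat.choose_le_two_pow _ _).trans ?_
  rw [pow_mul]; norm_num

/-- The Catalan recursion with a weight, as it arises from the Burgers equation. -/
theorem sum_antidiagonal_catalan_mul (n : ℕ) :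
    ∑ ij ∈ Finset.HasAntidiagonal.antidiagonal n, catalan ij.1 * catalan ij.2 * (2 * ij.2 + 1) =
      (n + 1) * catalan (n + 1) := by
  have h : ∑ ij ∈ Finset.HasAntidiagonal.antidiagonal n, catalan ij.1 * catalan ij.2 * (2 * ij.2 + 1) =
      ∑ ij ∈ Finset.HasAntidiagonal.antidiagonal n, catalan ij.1 * catalan ij.2 * (2 * ij.1 + 1) := by
    rw [← Finset.Nat.sum_antidiagonal_swap]
    exact Finset.sum_congr rfl fun ij _ => by simp [mul_comm]
  have h2 : 2 * ∑ ij ∈ Finset.HasAntidiagonal.antidiagonal n, catalan ij.1 * catalan ij.2 * (2 * ij.2 + 1) =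
      2 * ((n + 1) * catalan (n + 1)) := by
    conv_lhs => rw [two_mul]; enter [2]; rw [h]
    rw [← Finset.sum_add_distrib, catalan_succ', Finset.mul_sum, Finset.mul_sum]
    refine Finset.sum_congr rfl fun ij hij => ?_
    rw [← Finset.HasAntidiagonal.mem_antidiagonal.1 hij]
    ring
  omega

section Coefficients

set_option maxSynthPendingDepth 3

variable {E V : Type*} [NormedAddCommGroup E] [NormedSpace ℝ E]
  [NormedAddCommGroup V] [NormedSpace ℝ V]
  (B : V →L[ℝ] (E →L[ℝ] V) →L[ℝ] V) (L : (E →L[ℝ] V) →L[ℝ] V) (u₀ : E → V)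

/-- The Taylor coefficients in `t` of the solution of `u_t = B(u, Du) + L(Du)`, `u(·, 0) = u₀`. -/
noncomputable def cauchyCoeff : ℕ → E → V
  | 0 => u₀
  | n + 1 => fun x => ((n : ℝ) + 1)⁻¹ •
      (∑ i : Fin (n + 1), B (cauchyCoeff i x) (fderiv ℝ (cauchyCoeff (n - i)) x) +
        L (fderiv ℝ (cauchyCoeff n) x))
  decreasing_by all_goals omega

theorem cauchyCoeff_zero : cauchyCoeff B L u₀ 0 = u₀ := by rw [cauchyCoeff]

theorem cauchyCoeff_succ (n : ℕ) : cauchyCoeff B L u₀ (n + 1) = fun x => ((n : ℝ) + 1)⁻¹ •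
    (∑ ij ∈ Finset.HasAntidiagonal.antidiagonal n,
        B (cauchyCoeff B L u₀ ij.1 x) (fderiv ℝ (cauchyCoeff B L u₀ ij.2) x) +
      L (fderiv ℝ (cauchyCoeff B L u₀ n) x)) := by
  rw [cauchyCoeff]
  funext x
  rw [Finset.Nat.sum_antidiagonal_eq_sum_range_succ
    (fun i j => B (cauchyCoeff B L u₀ i x) (fderiv ℝ (cauchyCoeff B L u₀ j) x)),
    Finset.sum_range]

variable {u₀}

theorem contDiff_cauchyCoeff (hu : ContDiff ℝ ω u₀) (n : ℕ) :
    ContDiff ℝ ω (cauchyCoeff B L u₀ n) := by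
  induction n using Nat.strong_induction_on with
  | _ n ih =>
    rcases n with _ | n
    · rwa [cauchyCoeff_zero]
    rw [cauchyCoeff_succ]
    have hD : ∀ m < n + 1, ContDiff ℝ ω (fderiv ℝ (cauchyCoeff B L u₀ m)) := fun m hm =>
      (ih m hm).fderiv_right le_rfl
    refine contDiff_const.smul ((ContDiff.sum fun ij hij => ?_).add
      (L.contDiff.comp (hD n n.lt_succ_self)))
    have := Finset.HasAntidiagonal.mem_antidiagonal.1 hij
    exact (B.contDiff.comp (ih ij.1 (by omega))).clm_apply (hD ij.2 (by omega))

theorem cauchyCoeff_add_period {c : E} (hc : ∀ x, u₀ (x + c) = u₀ x) (n : ℕ) (x : E) :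
    cauchyCoeff B L u₀ n (x + c) = cauchyCoeff B L u₀ n x := by
  induction n using Nat.strong_induction_on generalizing x with
  | _ n ih =>
    rcases n with _ | n
    · rw [cauchyCoeff_zero, hc]
    have hD : ∀ m < n + 1, fderiv ℝ (cauchyCoeff B L u₀ m) (x + c) =
        fderiv ℝ (cauchyCoeff B L u₀ m) x := by
      intro m hm
      rw [← fderiv_comp_add_right]
      congr 1
      exact funext (ih m hm)
    simp only [cauchyCoeff_succ]
    rw [hD n n.lt_succ_self]
    congr 2
    refine Finset.sum_congr rfl fun ij hij => ?_
    have := Finset.HasAntidiagonal.mem_antidiagonal.1 hij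
    rw [ih ij.1 (by omega), hD ij.2 (by omega)]

theorem norm_iteratedFDeriv_cauchyCoeff_le (hu : ContDiff ℝ ω u₀) {K R : ℝ} (hK : 1 ≤ K)
    (hR : 0 ≤ R) (hb : ∀ k x, ‖iteratedFDeriv ℝ k u₀ x‖ ≤ K * R ^ k * k !) (n k : ℕ) (x : E) :
    ‖iteratedFDeriv ℝ k (cauchyCoeff B L u₀ n) x‖ ≤
      K * ((‖B‖ + ‖L‖) * R * K) ^ n * catalan n * R ^ k * (2 * n + 1).ascFactorial k := by
  set M := (‖B‖ + ‖L‖) * R * K with hM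
  have hM0 : 0 ≤ M := by positivity
  induction n using Nat.strong_induction_on generalizing k with
  | _ n ih =>
    rcases n with _ | n
    · simpa [cauchyCoeff_zero] using hb k x
    set u := cauchyCoeff B L u₀ with hu_def
    have hC : ∀ m, ContDiff ℝ ω (u m) := contDiff_cauchyCoeff B L hu
    have hCD : ∀ m, ContDiff ℝ ω (fderiv ℝ (u m)) := fun m => (hC m).fderiv_right le_rfl
    have hB : ∀ ij ∈ Finset.HasAntidiagonal.antidiagonal n,
        ‖iteratedFDeriv ℝ k (fun y => B (u ij.1 y) (fderiv ℝ (u ij.2) y)) x‖ ≤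
          ‖B‖ * (K ^ 2 * M ^ n * R ^ (k + 1) * (2 * n + 3).ascFactorial k *
            (catalan ij.1 * catalan ij.2 * (2 * ij.2 + 1))) := by
      rintro ⟨i, j⟩ hij
      have hij' := Finset.HasAntidiagonal.mem_antidiagonal.1 hij
      simp only at hij' ⊢
      refine (B.norm_iteratedFDeriv_le_of_bilinear (hC i) (hCD j) x (n := k) le_top).trans ?_
      gcongr
      have hterm : ∀ l ∈ Finset.range (k + 1),
          (k.choose l : ℝ) * ‖iteratedFDeriv ℝ l (u i) x‖ *
            ‖iteratedFDeriv ℝ (k - l) (fderiv ℝ (u j)) x‖ ≤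
          K ^ 2 * M ^ n * R ^ (k + 1) * (catalan i * catalan j * (2 * j + 1)) *
            ((k.choose l * (2 * i + 1).ascFactorial l * (2 * j + 2).ascFactorial (k - l) : ℕ) : ℝ) := by
        intro l hl
        have hl' : l ≤ k := by simpa [Nat.lt_succ_iff] using hl
        rw [norm_iteratedFDeriv_fderiv]
        have h1 := ih i (by omega) l
        have h2 := ih j (by omega) (k - l + 1)
        rw [← Nat.mul_ascFactorial_succ] at h2
        calc _ ≤ (k.choose l : ℝ) * (K * M ^ i * catalan i * R ^ l * (2 * i + 1).ascFactorial l) *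
              (K * M ^ j * catalan j * R ^ (k - l + 1) *
                ((2 * j + 1) * (2 * j + 1 + 1).ascFactorial (k - l) : ℕ)) := by gcongr
          _ = _ := by
            have e1 : M ^ n = M ^ i * M ^ j := by rw [← hij', pow_add]
            have e2 : R ^ (k + 1) = R ^ l * R ^ (k - l + 1) := by
              rw [← pow_add]; congr 1; omega
            rw [e1, e2]
            push_cast
            ring
      refine (Finset.sum_le_sum hterm).trans (le_of_eq ?_)
      rw [← Finset.mul_sum, ← Nat.cast_sum, Nat.sum_choose_mul_ascFactorial]
      have e : 2 * i + 1 + (2 * j + 2) = 2 * n + 3 := by omega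
      rw [e]
      ring
    have hL : ‖iteratedFDeriv ℝ k (fun y => L (fderiv ℝ (u n) y)) x‖ ≤
        ‖L‖ * (K ^ 2 * M ^ n * R ^ (k + 1) * (2 * n + 3).ascFactorial k *
            ((n + 1) * catalan (n + 1))) := by
      refine (L.norm_iteratedFDeriv_comp_left (hCD n).contDiffAt (n := k) le_top).trans ?_
      gcongr
      rw [norm_iteratedFDeriv_fderiv]
      have h2 := ih n n.lt_succ_self (k + 1)
      rw [← Nat.mul_ascFactorial_succ] at h2
      have hcat : ((2 * n + 1 : ℕ) : ℝ) * catalan n ≤ (n + 1) * catalan (n + 1) := by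
        have := sum_antidiagonal_catalan_mul n
        have h0 := Finset.single_le_sum
          (f := fun ij : ℕ × ℕ => catalan ij.1 * catalan ij.2 * (2 * ij.2 + 1))
          (fun _ _ => Nat.zero_le _)
          (Finset.HasAntidiagonal.mem_antidiagonal.2 (zero_add n) : (0, n) ∈ Finset.HasAntidiagonal.antidiagonal n)
        rw [this] at h0
        simp only [catalan_zero, one_mul] at h0
        rw [mul_comm]
        exact_mod_cast h0
      calc _ ≤ _ := h2
        _ = K * M ^ n * R ^ (k + 1) * (2 * n + 2).ascFactorial k * ((2 * n + 1 : ℕ) * catalan n) := by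
          push_cast; ring
        _ ≤ K ^ 2 * M ^ n * R ^ (k + 1) * (2 * n + 3).ascFactorial k *
            ((n + 1) * catalan (n + 1)) := by
          have : K ≤ K ^ 2 := by nlinarith
          have h3 : (2 * n + 2).ascFactorial k ≤ (2 * n + 3).ascFactorial k :=
            Nat.ascFactorial_le k (by omega)
          gcongr
    have hsum : ∑ ij ∈ Finset.HasAntidiagonal.antidiagonal n,
        ((catalan ij.1 : ℝ) * catalan ij.2 * (2 * ij.2 + 1)) = (n + 1) * catalan (n + 1) := by
      exact_mod_cast sum_antidiagonal_catalan_mul n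
    have hCB : ∀ ij ∈ Finset.HasAntidiagonal.antidiagonal n,
        ContDiff ℝ ω (fun y => B (u ij.1 y) (fderiv ℝ (u ij.2) y)) := fun ij _ =>
      (B.contDiff.comp (hC ij.1)).clm_apply (hCD ij.2)
    have hCL : ContDiff ℝ ω (fun y => L (fderiv ℝ (u n) y)) := L.contDiff.comp (hCD n)
    have hkω : (k : WithTop ℕ∞) ≤ ω := le_top
    have hn0 : (0 : ℝ) < (n : ℝ) + 1 := by positivity
    rw [hu_def, cauchyCoeff_succ, ← hu_def]
    rw [iteratedFDeriv_const_smul_apply' (((ContDiff.sum hCB).add hCL).contDiffAt.of_le hkω),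
      norm_smul, norm_inv, Real.norm_of_nonneg hn0.le, inv_mul_le_iff₀ hn0,
      fun_iteratedFDeriv_add_apply ((ContDiff.sum hCB).contDiffAt.of_le hkω) (hCL.contDiffAt.of_le hkω),
      iteratedFDeriv_fun_sum_apply fun ij hij => (hCB ij hij).contDiffAt.of_le hkω]
    refine (norm_add_le _ _).trans ((add_le_add ((norm_sum_le _ _).trans
      (Finset.sum_le_sum hB)) hL).trans (le_of_eq ?_))
    rw [← Finset.mul_sum, ← Finset.mul_sum, hsum]
    have e : 2 * (n + 1) + 1 = 2 * n + 3 := by ring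
    rw [e, hM]
    ring

theorem exists_norm_iteratedFDeriv_cauchyCoeff_le (hu : ContDiff ℝ ω u₀) {K R : ℝ}
    (hb : ∀ k x, ‖iteratedFDeriv ℝ k u₀ x‖ ≤ K * R ^ k * k !) :
    ∃ C A ρ : ℝ, 0 < C ∧ 0 < A ∧ 0 < ρ ∧ ∀ n k x,
      ‖iteratedFDeriv ℝ k (cauchyCoeff B L u₀ n) x‖ ≤ C * A ^ n * ρ ^ k * k ! := by
  have hb' : ∀ k x, ‖iteratedFDeriv ℝ k u₀ x‖ ≤ (|K| + 1) * (|R| + 1) ^ k * k ! := by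
    intro k x
    refine (hb k x).trans ?_
    refine mul_le_mul_of_nonneg_right ((le_abs_self _).trans ?_) (by positivity)
    rw [abs_mul, abs_pow]
    gcongr <;> linarith
  have hK : 1 ≤ |K| + 1 := by linarith [abs_nonneg K]
  have hR : 0 ≤ |R| + 1 := by positivity
  set M := (‖B‖ + ‖L‖) * (|R| + 1) * (|K| + 1) with hM
  refine ⟨|K| + 1, 16 * (M + 1), 2 * (|R| + 1), by positivity, by positivity, by positivity,
    fun n k x => ?_⟩
  refine (norm_iteratedFDeriv_cauchyCoeff_le B L hu hK hR hb' n k x).trans ?_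
  have h1 : (catalan n : ℝ) ≤ 4 ^ n := by exact_mod_cast catalan_le_four_pow n
  have h2 : ((2 * n + 1).ascFactorial k : ℝ) ≤ 4 ^ n * 2 ^ k * k ! := by
    exact_mod_cast Nat.ascFactorial_le_two_pow_mul_factorial n k
  calc _ ≤ (|K| + 1) * (M + 1) ^ n * 4 ^ n * (|R| + 1) ^ k * (4 ^ n * 2 ^ k * k !) := by
        rw [← hM]
        gcongr
        linarith
    _ = _ := by
      rw [mul_pow, mul_pow, show (16 : ℝ) = 4 * 4 by norm_num, mul_pow]
      ring

end Coefficients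

section Bilinear
set_option maxSynthPendingDepth 3
variable {X Y Z : Type*} [NormedAddCommGroup X] [NormedSpace ℝ X] [CompleteSpace X]
  [NormedAddCommGroup Y] [NormedSpace ℝ Y] [CompleteSpace Y]
  [NormedAddCommGroup Z] [NormedSpace ℝ Z] [CompleteSpace Z]

/-- Cauchy product of absolutely convergent series along a continuous bilinear map. -/
theorem ContinuousLinearMap.hasSum_sum_antidiagonal (B : X →L[ℝ] Y →L[ℝ] Z) {a : ℕ → X}
    {d : ℕ → Y} (ha : Summable fun n => ‖a n‖) (hd : Summable fun n => ‖d n‖) :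
    HasSum (fun n => ∑ ij ∈ Finset.HasAntidiagonal.antidiagonal n, B (a ij.1) (d ij.2))
      (B (∑' n, a n) (∑' n, d n)) := by
  have hs : Summable fun z : ℕ × ℕ => B (a z.1) (d z.2) := by
    have hn : Summable fun z : ℕ × ℕ => ‖B‖ * (‖a z.1‖ * ‖d z.2‖) :=
      (ha.mul_of_nonneg hd (fun _ => norm_nonneg _) fun _ => norm_nonneg _).mul_left ‖B‖
    refine hn.of_norm_bounded fun z => ?_
    rw [← mul_assoc]
    exact B.le_opNorm₂ _ _
  have h1 : HasSum (fun i => B (a i) (∑' n, d n)) (∑' z : ℕ × ℕ, B (a z.1) (d z.2)) :=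
    hs.hasSum.prod_fiberwise fun i => (B (a i)).hasSum hd.of_norm.hasSum
  have h2 : HasSum (fun i => B (a i) (∑' n, d n)) (B (∑' n, a n) (∑' n, d n)) :=
    (B.flip (∑' n, d n)).hasSum ha.of_norm.hasSum
  rw [h2.unique h1]
  have h3 := (Finset.HasAntidiagonal.sigmaAntidiagonalEquivProd (A := ℕ)).hasSum_iff.2 hs.hasSum
  refine h3.sigma fun n => ?_
  exact (Finset.hasSum (Finset.HasAntidiagonal.antidiagonal n) fun ij => B (a ij.1) (d ij.2))

end Bilinear

section Solution
set_option maxSynthPendingDepth 3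
variable {E V : Type*} [NormedAddCommGroup E] [NormedSpace ℝ E]
  [NormedAddCommGroup V] [NormedSpace ℝ V]

theorem norm_iteratedFDeriv_pow_snd_smul_le {v : E → V} (hv : ContDiff ℝ ω v) {c ρ : ℝ} {x : E}
    (hb : ∀ k, ‖iteratedFDeriv ℝ k v x‖ ≤ c * ρ ^ k * k !) (n k : ℕ) :
    (k ! : ℝ)⁻¹ * ‖iteratedFDeriv ℝ k (fun p : E × ℝ => p.2 ^ n • v p.1) (x, 0)‖ ≤
      if n ≤ k then c * ρ ^ (k - n) else 0 := by
  have hk0 : (0 : ℝ) < k ! := by exact_mod_cast k.factorial_pos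
  have hpow : ContDiff ℝ ω fun s : ℝ => s ^ n := contDiff_id.pow n
  have h1 : ∀ i, ‖iteratedFDeriv ℝ i (fun p : E × ℝ => p.2 ^ n) (x, 0)‖ ≤
      if i = n then (n ! : ℝ) else 0 := by
    intro i
    have := (ContinuousLinearMap.snd ℝ E ℝ).iteratedFDeriv_comp_right hpow (x, (0 : ℝ))
      (i := i) le_top
    change ‖iteratedFDeriv ℝ i ((fun s : ℝ => s ^ n) ∘ ContinuousLinearMap.snd ℝ E ℝ) (x, 0)‖ ≤ _
    rw [this]
    refine (ContinuousMultilinearMap.norm_compContinuousLinearMap_le _ _).trans ?_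
    rw [norm_iteratedFDeriv_eq_norm_iteratedDeriv, ContinuousLinearMap.coe_snd',
      iteratedDeriv_fun_pow_zero]
    rw [Finset.prod_const]
    split_ifs with h
    · rw [norm_natCast]
      refine mul_le_of_le_one_right (by positivity) ?_
      exact pow_le_one₀ (norm_nonneg _) (ContinuousLinearMap.norm_snd_le ℝ E ℝ)
    · simp
  have h2 : ∀ i, ‖iteratedFDeriv ℝ i (fun p : E × ℝ => v p.1) (x, 0)‖ ≤ c * ρ ^ i * i ! := by
    intro i
    have := (ContinuousLinearMap.fst ℝ E ℝ).iteratedFDeriv_comp_right hv (x, (0 : ℝ))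
      (i := i) le_top
    change ‖iteratedFDeriv ℝ i (v ∘ ContinuousLinearMap.fst ℝ E ℝ) (x, 0)‖ ≤ _
    rw [this]
    refine (ContinuousMultilinearMap.norm_compContinuousLinearMap_le _ _).trans ?_
    rw [Finset.prod_const]
    refine le_trans (mul_le_of_le_one_right (norm_nonneg _) ?_) (hb i)
    exact pow_le_one₀ (norm_nonneg _) (ContinuousLinearMap.norm_fst_le ℝ E ℝ)
  rw [inv_mul_le_iff₀ hk0]
  refine (norm_iteratedFDeriv_smul_le (hpow.comp contDiff_snd) (hv.comp contDiff_fst) _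
    (n := k) le_top).trans ?_
  have h3 : ∀ i ∈ Finset.range (k + 1),
      (k.choose i : ℝ) * ‖iteratedFDeriv ℝ i (fun p : E × ℝ => p.2 ^ n) (x, 0)‖ *
        ‖iteratedFDeriv ℝ (k - i) (fun p : E × ℝ => v p.1) (x, 0)‖ ≤
      if i = n then (k.choose n : ℝ) * n ! * (c * ρ ^ (k - n) * (k - n)!) else 0 := by
    intro i _
    have h1 := h1 i
    split_ifs with h
    · subst h
      rw [if_pos rfl] at h1
      gcongr
      exact h2 _
    · rw [if_neg h] at h1
      rw [le_antisymm h1 (norm_nonneg _)]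
      simp
  refine (Finset.sum_le_sum h3).trans ?_
  rw [Finset.sum_ite_eq']
  simp only [Finset.mem_range, Nat.lt_succ_iff]
  split_ifs with h
  · have := Nat.choose_mul_factorial_mul_factorial h
    rw [← this]
    push_cast
    apply le_of_eq
    ring
  · simp

theorem summable_ite_pow_mul_pow {A ρ r : ℝ} (C : ℝ) (hA : 0 ≤ A) (hρ : 0 ≤ ρ) (hr : 0 ≤ r)
    (hAr : A * r < 1) (hρr : ρ * r < 1) :
    Summable fun z : ℕ × ℕ => (if z.1 ≤ z.2 then C * A ^ z.1 * ρ ^ (z.2 - z.1) else 0) * r ^ z.2 := by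
  have hinj : Function.Injective fun z : ℕ × ℕ => (z.1, z.1 + z.2) := by
    rintro ⟨a, b⟩ ⟨c, d⟩ h
    simp only [Prod.mk.injEq] at h ⊢
    omega
  refine (hinj.summable_iff ?_).1 ?_
  · rintro ⟨n, k⟩ h
    have : ¬ n ≤ k := fun hnk => h ⟨(n, k - n), by simp [Nat.add_sub_cancel' hnk]⟩
    simp [this]
  · have := ((summable_geometric_of_lt_one (by positivity) hAr).mul_of_nonneg
      (summable_geometric_of_lt_one (by positivity) hρr) (fun _ => by positivity)
      (fun _ => by positivity)).mul_left C
    refine this.congr fun z => ?_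
    simp only [Function.comp, Nat.le_add_right, if_true, Nat.add_sub_cancel_left]
    rw [mul_pow, mul_pow, pow_add]
    ring

variable [CompleteSpace V]

theorem hasDerivAt_tsum_pow_smul {a : ℕ → V} {A C r t : ℝ} (hA : 0 ≤ A) (hr : 0 < r)
    (hAr : A * r < 1) (ha : ∀ n, ‖a n‖ ≤ C * A ^ n) (ht : t ∈ Ioo (-r) r) :
    HasDerivAt (fun s : ℝ => ∑' n, s ^ n • a n) (∑' n : ℕ, ((n : ℝ) * t ^ (n - 1)) • a n) t := by
  have hAr' : ‖A * r‖ < 1 := by rwa [Real.norm_of_nonneg (by positivity)]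
  have hsum : Summable fun n : ℕ => C * r⁻¹ * ((n : ℝ) ^ 1 * (A * r) ^ n) :=
    Summable.mul_left (C * r⁻¹) (summable_pow_mul_geometric_of_norm_lt_one 1 hAr')
  have hd : ∀ (n : ℕ) (s : ℝ), s ∈ Ioo (-r) r →
      HasDerivAt (fun s : ℝ => s ^ n • a n) (((n : ℝ) * s ^ (n - 1)) • a n) s :=
    fun n s _ => (hasDerivAt_pow n s).smul_const (a n)
  have hbd : ∀ (n : ℕ) (s : ℝ), s ∈ Ioo (-r) r →
      ‖((n : ℝ) * s ^ (n - 1)) • a n‖ ≤ C * r⁻¹ * ((n : ℝ) ^ 1 * (A * r) ^ n) := by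
    intro n s hs
    rw [norm_smul, norm_mul, norm_natCast, norm_pow, Real.norm_eq_abs]
    rcases n with _ | n
    · simp
    rw [Nat.add_sub_cancel]
    have h1 : ((n + 1 : ℕ) : ℝ) * |s| ^ n * ‖a (n + 1)‖ ≤
        ((n + 1 : ℕ) : ℝ) * r ^ n * (C * A ^ (n + 1)) := by
      gcongr
      exacts [(abs_lt.2 hs).le, ha _]
    refine h1.trans (le_of_eq ?_)
    rw [mul_pow, pow_succ r n]
    field_simp
  have h0 : Summable fun n => (0 : ℝ) ^ n • a n :=
    summable_of_ne_finset_zero (s := {0}) fun n hn => by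
      rw [zero_pow (by simpa using hn), zero_smul]
  exact hasDerivAt_tsum_of_isPreconnected hsum isOpen_Ioo isPreconnected_Ioo hd hbd
    (mem_Ioo.2 ⟨neg_lt_zero.2 hr, hr⟩) h0 ht

/-- Local solvability of the analytic Cauchy problem `u_t = B(u, Du) + L(Du)`, `u(·, 0) = u₀`,
uniformly in space for initial data with uniform Cauchy estimates. -/
theorem exists_analytic_solution (B : V →L[ℝ] (E →L[ℝ] V) →L[ℝ] V) (L : (E →L[ℝ] V) →L[ℝ] V)
    {u₀ : E → V} (hu : ContDiff ℝ ω u₀) {K R : ℝ}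
    (hb : ∀ k x, ‖iteratedFDeriv ℝ k u₀ x‖ ≤ K * R ^ k * k !) :
    ∃ ε > 0, ∃ u : E × ℝ → V, AnalyticOnNhd ℝ u {p | p.2 ∈ Ioo (-ε) ε} ∧
      (∀ c : E, (∀ x, u₀ (x + c) = u₀ x) → ∀ x t, u (x + c, t) = u (x, t)) ∧
      (∀ x, u (x, 0) = u₀ x) ∧
      ∀ x, ∀ t ∈ Ioo (-ε) ε, HasDerivAt (fun s => u (x, s))
        (B (u (x, t)) (fderiv ℝ (fun y => u (y, t)) x) + L (fderiv ℝ (fun y => u (y, t)) x)) t := by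
  obtain ⟨C, A, ρ, hC, hA, hρ, hbd⟩ := exists_norm_iteratedFDeriv_cauchyCoeff_le B L hu hb
  set c := cauchyCoeff B L u₀ with hc
  have hcs : ∀ n, ContDiff ℝ ω (c n) := contDiff_cauchyCoeff B L hu
  obtain ⟨r, hr, hAr, hρr⟩ : ∃ r : ℝ≥0, 0 < r ∧ A * r < 1 ∧ ρ * r < 1 := by
    have h0 : 0 < A + ρ + 1 := by positivity
    refine ⟨⟨(A + ρ + 1)⁻¹, by positivity⟩, inv_pos.2 h0, ?_, ?_⟩ <;>
    · change _ * (A + ρ + 1)⁻¹ < 1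
      rw [← div_eq_mul_inv, div_lt_one h0]
      linarith
  have hr' : (0 : ℝ) < r := by exact_mod_cast hr
  have hc0 : ∀ n x, ‖c n x‖ ≤ C * A ^ n := fun n x => by simpa using hbd n 0 x
  have hc1 : ∀ n x, ‖fderiv ℝ (c n) x‖ ≤ C * A ^ n * ρ := fun n x => by
    have := hbd n 1 x
    rwa [← zero_add 1, ← norm_iteratedFDeriv_fderiv, norm_iteratedFDeriv_zero, zero_add, pow_one,
      Nat.factorial_one, Nat.cast_one, mul_one] at this
  have hgeo : Summable fun n : ℕ => (A * r) ^ n :=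
    summable_geometric_of_lt_one (by positivity) hAr
  have habs : ∀ t ∈ Ioo (-(r : ℝ)) r, |t| ≤ r := fun t ht => (abs_lt.2 ht).le
  have hn0 : ∀ t ∈ Ioo (-(r : ℝ)) r, ∀ n x, ‖t ^ n • c n x‖ ≤ C * (A * r) ^ n := by
    intro t ht n x
    rw [norm_smul, norm_pow, Real.norm_eq_abs, mul_pow]
    calc _ ≤ (r : ℝ) ^ n * (C * A ^ n) := by
          gcongr
          exacts [habs t ht, hc0 n x]
      _ = _ := by ring
  have hn1 : ∀ t ∈ Ioo (-(r : ℝ)) r, ∀ n x, ‖t ^ n • fderiv ℝ (c n) x‖ ≤ C * ρ * (A * r) ^ n := by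
    intro t ht n x
    rw [norm_smul, norm_pow, Real.norm_eq_abs, mul_pow]
    calc _ ≤ (r : ℝ) ^ n * (C * A ^ n * ρ) := by
          gcongr
          exacts [habs t ht, hc1 n x]
      _ = _ := by ring
  have hs0 : ∀ t ∈ Ioo (-(r : ℝ)) r, ∀ x, Summable fun n => ‖t ^ n • c n x‖ := fun t ht x =>
    Summable.of_nonneg_of_le (fun _ => norm_nonneg _) (hn0 t ht · x) (hgeo.mul_left C)
  have hs1 : ∀ t ∈ Ioo (-(r : ℝ)) r, ∀ x, Summable fun n => ‖t ^ n • fderiv ℝ (c n) x‖ :=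
    fun t ht x => Summable.of_nonneg_of_le (fun _ => norm_nonneg _) (hn1 t ht · x)
      (hgeo.mul_left (C * ρ))
  refine ⟨r, hr', fun p => ∑' n, p.2 ^ n • c n p.1, ?_, ?_, ?_, ?_⟩
  · rintro ⟨x, t⟩ ht
    have hw : ∀ n, AnalyticOnNhd ℝ (fun p : E × ℝ => p.2 ^ n • c n p.1) univ := fun n =>
      contDiff_omega_iff_analyticOnNhd.1 ((contDiff_snd.pow n).smul ((hcs n).comp contDiff_fst))
    obtain ⟨q, hq⟩ := hasFPowerSeriesOnBall_tsum hw (x, 0) hr (fun n k =>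
      mul_le_mul_of_nonneg_right (norm_iteratedFDeriv_pow_snd_smul_le (hcs n) (hbd n · x) n k)
        (by positivity)) (summable_ite_pow_mul_pow C hA.le hρ.le hr'.le hAr hρr)
    refine hq.analyticAt_of_mem ?_
    rw [Metric.eball_coe, Metric.mem_ball, Prod.dist_eq]
    simpa [hr', Real.norm_eq_abs, abs_lt] using ht
  · intro d hd x t
    simp only [hc, cauchyCoeff_add_period B L hd]
  · intro x
    have h0 : ∀ n ≠ 0, (0 : ℝ) ^ n • c n x = 0 := fun n hn => by simp [hn]
    dsimp only
    rw [tsum_eq_single 0 h0, hc, cauchyCoeff_zero, pow_zero, one_smul]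
  · intro x t ht
    have hDn : ∀ n y, HasFDerivAt (fun y => t ^ n • c n y) (t ^ n • fderiv ℝ (c n) y) y :=
      fun n y => (((hcs n).differentiable (by simp)) y).hasFDerivAt.const_smul (t ^ n)
    have hD : HasFDerivAt (fun y => ∑' n, t ^ n • c n y) (∑' n, t ^ n • fderiv ℝ (c n) x) x :=
      hasFDerivAt_tsum (hgeo.mul_left (C * ρ)) hDn (hn1 t ht) (hs0 t ht x).of_norm x
    have hT := hasDerivAt_tsum_pow_smul hA.le hr' hAr (hc0 · x) ht
    dsimp only
    rw [hD.fderiv]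
    convert hT using 1
    have hsT := (B.hasSum_sum_antidiagonal (hs0 t ht x) (hs1 t ht x)).add
      (L.hasSum (hs1 t ht x).of_norm.hasSum)
    have hterm : ∀ n, ∑ ij ∈ Finset.HasAntidiagonal.antidiagonal n,
          B (t ^ ij.1 • c ij.1 x) (t ^ ij.2 • fderiv ℝ (c ij.2) x) +
        L (t ^ n • fderiv ℝ (c n) x) = (((n + 1 : ℕ) : ℝ) * t ^ (n + 1 - 1)) • c (n + 1) x := by
      intro n
      have hn : ((n : ℝ) + 1) ≠ 0 := by positivity
      have hB : ∀ ij ∈ Finset.HasAntidiagonal.antidiagonal n,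
          B (t ^ ij.1 • c ij.1 x) (t ^ ij.2 • fderiv ℝ (c ij.2) x) =
            t ^ n • B (c ij.1 x) (fderiv ℝ (c ij.2) x) := by
        intro ij hij
        rw [map_smul, map_smul, smul_apply, smul_smul, ← pow_add,
          add_comm ij.2, Finset.HasAntidiagonal.mem_antidiagonal.1 hij]
      rw [Finset.sum_congr rfl hB, ← Finset.smul_sum, map_smul, ← smul_add, hc, cauchyCoeff_succ,
        smul_smul, Nat.add_sub_cancel, Nat.cast_add_one, mul_right_comm, mul_inv_cancel₀ hn,
        one_mul]
    simp only [hterm] at hsT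
    have hsT' : HasSum (fun n : ℕ => ((n : ℝ) * t ^ (n - 1)) • c n x)
        (B (∑' n, t ^ n • c n x) (∑' n, t ^ n • fderiv ℝ (c n) x) +
          L (∑' n, t ^ n • fderiv ℝ (c n) x)) := by
      rw [← hasSum_nat_add_iff' 1, Finset.sum_range_one, Nat.cast_zero, zero_mul, zero_smul,
        sub_zero]
      exact hsT
    exact hsT'.tsum_eq.symm

end Solution

section Existence
set_option maxSynthPendingDepth 3

theorem exists_norm_iteratedFDeriv_le_of_periodic {V : Type*} [NormedAddCommGroup V]
    [NormedSpace ℝ V] [CompleteSpace V] {u₀ : ℝ × ℝ → V} (hu : AnalyticOnNhd ℝ u₀ univ)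
    (h1 : Function.Periodic u₀ (1, 0)) (h2 : Function.Periodic u₀ (0, 1)) :
    ∃ K R : ℝ, ∀ k x, ‖iteratedFDeriv ℝ k u₀ x‖ ≤ K * R ^ k * k ! := by
  have hcpt : IsCompact (Icc (0 : ℝ) 1 ×ˢ Icc (0 : ℝ) 1) := isCompact_Icc.prod isCompact_Icc
  obtain ⟨K, R, hKR⟩ : ∃ K R : ℝ, ∀ x ∈ Icc (0 : ℝ) 1 ×ˢ Icc (0 : ℝ) 1, ∀ k : ℕ,
      ‖iteratedFDeriv ℝ k u₀ x‖ ≤ K * R ^ k * k ! := by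
    refine hcpt.induction_on (p := fun s => ∃ K R : ℝ, ∀ x ∈ s, ∀ k : ℕ,
      ‖iteratedFDeriv ℝ k u₀ x‖ ≤ K * R ^ k * k !) ⟨0, 0, by simp⟩ ?_ ?_ ?_
    · rintro s t hst ⟨K, R, h⟩
      exact ⟨K, R, fun x hx => h x (hst hx)⟩
    · rintro s t ⟨K, R, h⟩ ⟨K', R', h'⟩
      have aux : ∀ a b : ℝ, |a| ≤ |K| + |K'| → |b| ≤ |R| + |R'| → ∀ k : ℕ,
          a * b ^ k * k ! ≤ (|K| + |K'|) * (|R| + |R'|) ^ k * k ! := by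
        intro a b ha hb k
        refine mul_le_mul_of_nonneg_right ((le_abs_self _).trans ?_) (by positivity)
        rw [abs_mul, abs_pow]
        gcongr
      refine ⟨|K| + |K'|, |R| + |R'|, ?_⟩
      rintro x (hx | hx) k
      · exact (h x hx k).trans (aux _ _ (by simp) (by simp) k)
      · exact (h' x hx k).trans (aux _ _ (by simp) (by simp) k)
    · intro x _
      obtain ⟨K, R, h⟩ := (hu x (mem_univ _)).exists_iteratedFDeriv_bound
      exact ⟨_, mem_nhdsWithin_of_mem_nhds h, K, R, fun y hy => hy⟩
  refine ⟨K, R, fun k x => ?_⟩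
  have hper : ∀ c, Function.Periodic u₀ c → Function.Periodic (iteratedFDeriv ℝ k u₀) c := by
    intro c hc y
    rw [← iteratedFDeriv_comp_add_right]
    congr 1
    exact funext hc
  rw [← (hper _ h1).sub_zsmul_eq ⌊x.1⌋, ← (hper _ h2).sub_zsmul_eq ⌊x.2⌋]
  refine hKR _ ⟨?_, ?_⟩ k
  · simpa using (Int.fract_lt_one x.1).le
  · simpa using (Int.fract_lt_one x.2).le

/-- The quadratic part of system (11), for the unknown `(Λ, u₀, f, g)` and its differential. -/
noncomputable def systemBilinear :
    (ℝ × ℝ × ℝ × ℝ) →L[ℝ] (ℝ × ℝ →L[ℝ] ℝ × ℝ × ℝ × ℝ) →L[ℝ] ℝ × ℝ × ℝ × ℝ :=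
  (LinearMap.mk₂ ℝ (fun (v : ℝ × ℝ × ℝ × ℝ) (M : ℝ × ℝ →L[ℝ] ℝ × ℝ × ℝ × ℝ) =>
    (v.2.2.2 * (M (1, 0)).1 + v.1 * (M (1, 0)).2.2.2 +
        v.2.2.1 * (M (0, 1)).1 + v.1 * (M (0, 1)).2.2.1,
      -2 * v.2.2.2 * (M (1, 0)).1 + v.2.2.2 * (M (1, 0)).2.1 - 2 * v.1 * (M (1, 0)).2.2.2 +
        2 * v.2.2.1 * (M (0, 1)).1 + v.2.2.1 * (M (0, 1)).2.1 + 2 * v.1 * (M (0, 1)).2.2.1,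
      (0 : ℝ), (0 : ℝ)))
    (fun _ _ _ => by ext <;> simp <;> ring) (fun _ _ _ => by ext <;> simp <;> ring)
    (fun _ _ _ => by ext <;> simp <;> ring)
    (fun _ _ _ => by ext <;> simp <;> ring)).toContinuousBilinearMap

/-- The linear part of system (11), for the differential of the unknown `(Λ, u₀, f, g)`. -/
noncomputable def systemLinear : (ℝ × ℝ →L[ℝ] ℝ × ℝ × ℝ × ℝ) →L[ℝ] ℝ × ℝ × ℝ × ℝ :=
  LinearMap.toContinuousLinearMap
    { toFun := fun M => (0, 0, 2 * (M (0, 1)).2.1, -2 * (M (1, 0)).2.1)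
      map_add' := fun _ _ => by ext <;> simp <;> ring
      map_smul' := fun _ _ => by ext <;> simp <;> ring }

theorem systemBilinear_add_systemLinear (v : ℝ × ℝ × ℝ × ℝ) (M : ℝ × ℝ →L[ℝ] ℝ × ℝ × ℝ × ℝ) :
    systemBilinear v M + systemLinear M =
      (v.2.2.2 * (M (1, 0)).1 + v.1 * (M (1, 0)).2.2.2 +
        v.2.2.1 * (M (0, 1)).1 + v.1 * (M (0, 1)).2.2.1,
      -2 * v.2.2.2 * (M (1, 0)).1 + v.2.2.2 * (M (1, 0)).2.1 - 2 * v.1 * (M (1, 0)).2.2.2 +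
        2 * v.2.2.1 * (M (0, 1)).1 + v.2.2.1 * (M (0, 1)).2.1 + 2 * v.1 * (M (0, 1)).2.2.1,
      2 * (M (0, 1)).2.1, -2 * (M (1, 0)).2.1) := by
  ext <;> simp [systemBilinear, systemLinear]

/-- The scalar function of `(x, y, t)` obtained from a component of a vector function of
`((x, y), t)`. -/
def stripComponent {V : Type*} [NormedAddCommGroup V] [NormedSpace ℝ V] (u : (ℝ × ℝ) × ℝ → V)
    (ℓ : V →L[ℝ] ℝ) (p : ℝ × ℝ × ℝ) : ℝ :=
  ℓ (u ((p.1, p.2.1), p.2.2))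

section Component
variable {V : Type*} [NormedAddCommGroup V] [NormedSpace ℝ V] {u : (ℝ × ℝ) × ℝ → V}
  (ℓ : V →L[ℝ] ℝ) {p : ℝ × ℝ × ℝ}

theorem analyticOnNhd_stripComponent {ε : ℝ} (hu : AnalyticOnNhd ℝ u {p | p.2 ∈ Ioo (-ε) ε}) :
    AnalyticOnNhd ℝ (stripComponent u ℓ) (Strip ε) := by
  intro p hp
  have h : AnalyticAt ℝ (fun q : ℝ × ℝ × ℝ => ((q.1, q.2.1), q.2.2)) p :=
    (ContinuousLinearEquiv.prodAssoc ℝ ℝ ℝ ℝ).symm.analyticAt p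
  exact (ℓ.analyticAt _).comp ((hu ((p.1, p.2.1), p.2.2) hp).comp_of_eq h rfl)

theorem fderiv_stripComponent (hu : DifferentiableAt ℝ u ((p.1, p.2.1), p.2.2)) (a b c : ℝ) :
    fderiv ℝ (stripComponent u ℓ) p (a, b, c) =
      ℓ (fderiv ℝ u ((p.1, p.2.1), p.2.2) ((a, b), c)) := by
  have h := ℓ.hasFDerivAt.comp p (hu.hasFDerivAt.comp p
    ((ContinuousLinearEquiv.prodAssoc ℝ ℝ ℝ ℝ).symm.hasFDerivAt (x := p)))
  have h' : HasFDerivAt (stripComponent u ℓ) _ p := h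
  rw [h'.fderiv]
  rfl

theorem pX_stripComponent (hu : DifferentiableAt ℝ u ((p.1, p.2.1), p.2.2)) :
    pX (stripComponent u ℓ) p =
      ℓ (fderiv ℝ (fun z => u (z, p.2.2)) (p.1, p.2.1) (1, 0)) := by
  have h : HasFDerivAt (fun z => u (z, p.2.2)) _ (p.1, p.2.1) :=
    hu.hasFDerivAt.comp (p.1, p.2.1) (hasFDerivAt_prodMk_left (p.1, p.2.1) p.2.2)
  rw [pX, fderiv_stripComponent ℓ hu, h.fderiv]
  simp

theorem pY_stripComponent (hu : DifferentiableAt ℝ u ((p.1, p.2.1), p.2.2)) :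
    pY (stripComponent u ℓ) p =
      ℓ (fderiv ℝ (fun z => u (z, p.2.2)) (p.1, p.2.1) (0, 1)) := by
  have h : HasFDerivAt (fun z => u (z, p.2.2)) _ (p.1, p.2.1) :=
    hu.hasFDerivAt.comp (p.1, p.2.1) (hasFDerivAt_prodMk_left (p.1, p.2.1) p.2.2)
  rw [pY, fderiv_stripComponent ℓ hu, h.fderiv]
  simp

theorem pT_stripComponent (hu : DifferentiableAt ℝ u ((p.1, p.2.1), p.2.2)) {v : V}
    (hv : HasDerivAt (fun s => u ((p.1, p.2.1), s)) v p.2.2) :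
    pT (stripComponent u ℓ) p = ℓ v := by
  have h : HasFDerivAt (fun s => u ((p.1, p.2.1), s)) _ p.2.2 :=
    hu.hasFDerivAt.comp p.2.2 (hasFDerivAt_prodMk_right (p.1, p.2.1) p.2.2)
  rw [pT, fderiv_stripComponent ℓ hu, ← h.hasDerivAt.unique hv]
  rfl

end Component

theorem exists_isCauchySolution {Λ₁ Λ₂ : ℝ → ℝ}
    (hΛ₁a : AnalyticOnNhd ℝ Λ₁ univ) (hΛ₂a : AnalyticOnNhd ℝ Λ₂ univ)
    (hΛ₁per : Function.Periodic Λ₁ 1) (hΛ₂per : Function.Periodic Λ₂ 1) :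
    ∃ ε > 0, ∃ Λ u₀ f g : ℝ × ℝ × ℝ → ℝ, IsCauchySolution Λ₁ Λ₂ ε Λ u₀ f g := by
  set w : ℝ × ℝ → ℝ × ℝ × ℝ × ℝ := fun z =>
    (Λ₁ z.1 + Λ₂ z.2, 2 * Λ₂ z.2 - 2 * Λ₁ z.1, 0, 0) with hw
  have hwa : AnalyticOnNhd ℝ w univ := by
    intro z _
    have h1 : AnalyticAt ℝ (fun z : ℝ × ℝ => Λ₁ z.1) z :=
      (hΛ₁a z.1 (mem_univ _)).fun_comp analyticAt_fst
    have h2 : AnalyticAt ℝ (fun z : ℝ × ℝ => Λ₂ z.2) z :=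
      (hΛ₂a z.2 (mem_univ _)).fun_comp analyticAt_snd
    exact (h1.add h2).prod (((analyticAt_const.mul h2).sub (analyticAt_const.mul h1)).prod
      (analyticAt_const.prod analyticAt_const))
  have hp1 : Function.Periodic w (1, 0) := fun z => by simp [hw, hΛ₁per z.1]
  have hp2 : Function.Periodic w (0, 1) := fun z => by simp [hw, hΛ₂per z.2]
  obtain ⟨K, R, hKR⟩ := exists_norm_iteratedFDeriv_le_of_periodic hwa hp1 hp2
  obtain ⟨ε, hε, u, hua, huper, hu0, hut⟩ := exists_analytic_solution systemBilinear systemLinear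
    (contDiff_omega_iff_analyticOnNhd.2 hwa) hKR
  have hX := huper _ hp1
  have hY := huper _ hp2
  simp only [systemBilinear_add_systemLinear] at hut
  set S1 := ContinuousLinearMap.fst ℝ ℝ (ℝ × ℝ × ℝ)
  set S2 := (ContinuousLinearMap.fst ℝ ℝ (ℝ × ℝ)).comp
    (ContinuousLinearMap.snd ℝ ℝ (ℝ × ℝ × ℝ))
  set S3 := (ContinuousLinearMap.fst ℝ ℝ ℝ).comp ((ContinuousLinearMap.snd ℝ ℝ (ℝ × ℝ)).comp
    (ContinuousLinearMap.snd ℝ ℝ (ℝ × ℝ × ℝ)))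
  set S4 := (ContinuousLinearMap.snd ℝ ℝ ℝ).comp ((ContinuousLinearMap.snd ℝ ℝ (ℝ × ℝ)).comp
    (ContinuousLinearMap.snd ℝ ℝ (ℝ × ℝ × ℝ)))
  have hper : ∀ ℓ, DoublyPeriodicOn ε (stripComponent u ℓ) := by
    intro ℓ x y t _
    have h1 := hX (x, y) t
    have h2 := hY (x, y) t
    simp only [Prod.mk_add_mk, add_zero] at h1 h2
    exact ⟨congrArg ℓ h1, congrArg ℓ h2⟩
  refine ⟨ε, hε, stripComponent u S1, stripComponent u S2, stripComponent u S3,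
    stripComponent u S4, analyticOnNhd_stripComponent _ hua, analyticOnNhd_stripComponent _ hua,
    analyticOnNhd_stripComponent _ hua, analyticOnNhd_stripComponent _ hua,
    hper _, hper _, hper _, hper _, fun p hp => ?_, fun x y => ?_⟩
  · have hd : DifferentiableAt ℝ u ((p.1, p.2.1), p.2.2) :=
      (hua ((p.1, p.2.1), p.2.2) hp).differentiableAt
    have ht := hut (p.1, p.2.1) p.2.2 hp
    simp only [System11At, pX_stripComponent _ hd, pY_stripComponent _ hd,
      pT_stripComponent _ hd ht]
    exact ⟨rfl, rfl, rfl, rfl⟩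
  · simp only [stripComponent, hu0]
    exact ⟨rfl, rfl, rfl, rfl⟩

end Existence

section Uniqueness

/-- `h` and `k` have the same `t`-derivatives of order less than `n` on the plane `t = 0`. -/
def AgreeToOrder : ℕ → (ℝ × ℝ × ℝ → ℝ) → (ℝ × ℝ × ℝ → ℝ) → Prop
  | 0, _, _ => True
  | n + 1, h, k => (∀ x y, h (x, y, 0) = k (x, y, 0)) ∧ AgreeToOrder n (pT h) (pT k)

theorem isOpen_strip (δ : ℝ) : IsOpen (Strip δ) :=
  isOpen_Ioo.preimage (continuous_snd.comp continuous_snd)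

theorem mk_zero_mem_strip {δ : ℝ} (hδ : 0 < δ) (x y : ℝ) : (x, y, (0 : ℝ)) ∈ Strip δ :=
  ⟨neg_lt_zero.2 hδ, hδ⟩

theorem AnalyticOnNhd.fderiv_apply_const {h : ℝ × ℝ × ℝ → ℝ} {s : Set (ℝ × ℝ × ℝ)}
    (hh : AnalyticOnNhd ℝ h s) (v : ℝ × ℝ × ℝ) : AnalyticOnNhd ℝ (fun p => fderiv ℝ h p v) s :=
  fun p hp => ((ContinuousLinearMap.apply ℝ ℝ v).analyticAt _).comp (hh.fderiv p hp)

variable {δ : ℝ} {h h' k k' : ℝ × ℝ × ℝ → ℝ}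

theorem fderiv_apply_eqOn_strip (hk : EqOn h k (Strip δ)) (v : ℝ × ℝ × ℝ) :
    EqOn (fun p => fderiv ℝ h p v) (fun p => fderiv ℝ k p v) (Strip δ) := fun p hp => by
  have : h =ᶠ[𝓝 p] k := Filter.eventuallyEq_of_mem ((isOpen_strip δ).mem_nhds hp) hk
  simp only [this.fderiv_eq]

theorem hasDerivAt_pT {p : ℝ × ℝ × ℝ} (hd : DifferentiableAt ℝ h p) :
    HasDerivAt (fun s => h (p.1, p.2.1, s)) (pT h p) p.2.2 := by
  have h1 : HasDerivAt (fun s : ℝ => (p.1, p.2.1, s)) (0, 0, 1) p.2.2 :=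
    (hasDerivAt_const _ _).prodMk ((hasDerivAt_const _ _).prodMk (hasDerivAt_id _))
  exact hd.hasFDerivAt.comp_hasDerivAt p.2.2 h1

theorem fderiv_apply_horizontal {x y : ℝ} (hd : DifferentiableAt ℝ h (x, y, 0)) (a b : ℝ) :
    fderiv ℝ h (x, y, 0) (a, b, 0) = deriv (fun s => h (x + s * a, y + s * b, 0)) 0 := by
  have h1 : HasDerivAt (fun s : ℝ => (x + s * a, y + s * b, (0 : ℝ))) (a, b, 0) 0 :=
    (by simpa using ((hasDerivAt_id (0 : ℝ)).mul_const a).const_add x : HasDerivAt _ a (0 : ℝ)).prodMk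
      ((by simpa using ((hasDerivAt_id (0 : ℝ)).mul_const b).const_add y :
        HasDerivAt _ b (0 : ℝ)).prodMk (hasDerivAt_const _ _))
  have h2 : HasFDerivAt h (fderiv ℝ h (x, y, 0)) (x + 0 * a, y + 0 * b, (0 : ℝ)) := by
    simpa using hd.hasFDerivAt
  exact (h2.comp_hasDerivAt 0 h1).deriv.symm

theorem pT_fderiv_apply_comm {p : ℝ × ℝ × ℝ} (hh : AnalyticAt ℝ h p) (v : ℝ × ℝ × ℝ) :
    pT (fun q => fderiv ℝ h q v) p = fderiv ℝ (pT h) p v := by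
  have hd : DifferentiableAt ℝ (fderiv ℝ h) p := hh.fderiv.differentiableAt
  have hsymm : IsSymmSndFDerivAt ℝ h p := hh.contDiffAt.isSymmSndFDerivAt (n := ω) le_top
  have e : ∀ w u, fderiv ℝ (fun q => fderiv ℝ h q w) p u = fderiv ℝ (fderiv ℝ h) p u w := by
    intro w u
    rw [fderiv_clm_apply hd (differentiableAt_const w)]
    simp
  change fderiv ℝ (fun q => fderiv ℝ h q v) p _ = fderiv ℝ (fun q => fderiv ℝ h q _) p v
  rw [e, e, hsymm.eq]

namespace AgreeToOrder

theorem congr (hδ : 0 < δ) {n : ℕ} (H : AgreeToOrder n h k) (hh : EqOn h' h (Strip δ))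
    (hk : EqOn k' k (Strip δ)) : AgreeToOrder n h' k' := by
  induction n generalizing h h' k k' with
  | zero => trivial
  | succ n ih =>
    refine ⟨fun x y => ?_, ih H.2 (fderiv_apply_eqOn_strip hh _) (fderiv_apply_eqOn_strip hk _)⟩
    rw [hh (mk_zero_mem_strip hδ x y), hk (mk_zero_mem_strip hδ x y), H.1]

theorem of_succ {n : ℕ} (H : AgreeToOrder (n + 1) h k) : AgreeToOrder n h k := by
  induction n generalizing h k with
  | zero => trivial
  | succ n ih => exact ⟨H.1, ih H.2⟩

theorem refl (n : ℕ) (h : ℝ × ℝ × ℝ → ℝ) : AgreeToOrder n h h := by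
  induction n generalizing h with
  | zero => trivial
  | succ n ih => exact ⟨fun _ _ => rfl, ih _⟩

theorem add (hδ : 0 < δ) (hh : AnalyticOnNhd ℝ h (Strip δ)) (hh' : AnalyticOnNhd ℝ h' (Strip δ))
    (hk : AnalyticOnNhd ℝ k (Strip δ)) (hk' : AnalyticOnNhd ℝ k' (Strip δ)) {n : ℕ}
    (H : AgreeToOrder n h h') (K : AgreeToOrder n k k') :
    AgreeToOrder n (fun p => h p + k p) (fun p => h' p + k' p) := by
  induction n generalizing h h' k k' with
  | zero => trivial
  | succ n ih =>
    have e : ∀ {a b : ℝ × ℝ × ℝ → ℝ}, AnalyticOnNhd ℝ a (Strip δ) → AnalyticOnNhd ℝ b (Strip δ) →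
        EqOn (pT fun p => a p + b p) (fun p => pT a p + pT b p) (Strip δ) := by
      intro a b ha hb p hp
      simp only [pT]
      rw [fderiv_fun_add (ha p hp).differentiableAt (hb p hp).differentiableAt]
      rfl
    refine ⟨fun x y => by simp only [H.1, K.1],
      (ih ?_ ?_ ?_ ?_ H.2 K.2).congr hδ (e hh hk) (e hh' hk')⟩
    all_goals apply AnalyticOnNhd.fderiv_apply_const; assumption

theorem mul (hδ : 0 < δ) (hh : AnalyticOnNhd ℝ h (Strip δ)) (hh' : AnalyticOnNhd ℝ h' (Strip δ))
    (hk : AnalyticOnNhd ℝ k (Strip δ)) (hk' : AnalyticOnNhd ℝ k' (Strip δ)) {n : ℕ}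
    (H : AgreeToOrder n h h') (K : AgreeToOrder n k k') :
    AgreeToOrder n (fun p => h p * k p) (fun p => h' p * k' p) := by
  induction n generalizing h h' k k' with
  | zero => trivial
  | succ n ih =>
    have e : ∀ {a b : ℝ × ℝ × ℝ → ℝ}, AnalyticOnNhd ℝ a (Strip δ) → AnalyticOnNhd ℝ b (Strip δ) →
        EqOn (pT fun p => a p * b p) (fun p => a p * pT b p + b p * pT a p) (Strip δ) := by
      intro a b ha hb p hp
      simp only [pT]
      rw [fderiv_fun_mul (ha p hp).differentiableAt (hb p hp).differentiableAt]
      rfl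
    have d : ∀ {a : ℝ × ℝ × ℝ → ℝ}, AnalyticOnNhd ℝ a (Strip δ) → AnalyticOnNhd ℝ (pT a) (Strip δ) :=
      fun ha => ha.fderiv_apply_const _
    exact ⟨fun x y => by simp only [H.1, K.1],
      (AgreeToOrder.add hδ (hh.mul (d hk)) (hh'.mul (d hk')) (hk.mul (d hh)) (hk'.mul (d hh'))
        (ih hh hh' (d hk) (d hk') H.of_succ K.2) (ih hk hk' (d hh) (d hh') K.of_succ H.2)).congr hδ
        (e hh hk) (e hh' hk')⟩

theorem fderiv_apply (hδ : 0 < δ) (hh : AnalyticOnNhd ℝ h (Strip δ))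
    (hk : AnalyticOnNhd ℝ k (Strip δ)) {n : ℕ} (H : AgreeToOrder n h k) (a b : ℝ) :
    AgreeToOrder n (fun p => fderiv ℝ h p (a, b, 0)) (fun p => fderiv ℝ k p (a, b, 0)) := by
  induction n generalizing h k with
  | zero => trivial
  | succ n ih =>
    refine ⟨fun x y => ?_, (ih (hh.fderiv_apply_const _) (hk.fderiv_apply_const _) H.2).congr hδ
      (fun p hp => pT_fderiv_apply_comm (hh p hp) _) fun p hp => pT_fderiv_apply_comm (hk p hp) _⟩
    have hp := mk_zero_mem_strip hδ x y
    simp only [fderiv_apply_horizontal (hh _ hp).differentiableAt,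
      fderiv_apply_horizontal (hk _ hp).differentiableAt, H.1]

theorem iteratedDeriv_eq (hδ : 0 < δ) (hh : AnalyticOnNhd ℝ h (Strip δ))
    (hk : AnalyticOnNhd ℝ k (Strip δ)) {n : ℕ} (H : AgreeToOrder n h k) {i : ℕ} (hi : i < n)
    (x y : ℝ) :
    iteratedDeriv i (fun s => h (x, y, s)) 0 = iteratedDeriv i (fun s => k (x, y, s)) 0 := by
  induction n generalizing h k i with
  | zero => omega
  | succ n ih =>
    rcases i with _ | i
    · simpa using H.1 x y
    have e : ∀ {a : ℝ × ℝ × ℝ → ℝ}, AnalyticOnNhd ℝ a (Strip δ) →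
        deriv (fun s => a (x, y, s)) =ᶠ[𝓝 0] fun s => pT a (x, y, s) := by
      intro a ha
      filter_upwards [Ioo_mem_nhds (neg_lt_zero.2 hδ) hδ] with s hs
      exact (hasDerivAt_pT (ha (x, y, s) hs).differentiableAt).deriv
    rw [iteratedDeriv_succ', iteratedDeriv_succ', (e hh).iteratedDeriv_eq,
      (e hk).iteratedDeriv_eq]
    exact ih (hh.fderiv_apply_const _) (hk.fderiv_apply_const _) H.2 (by omega)

theorem eqOn_strip (hδ : 0 < δ) (hh : AnalyticOnNhd ℝ h (Strip δ))
    (hk : AnalyticOnNhd ℝ k (Strip δ)) (H : ∀ n, AgreeToOrder n h k) : EqOn h k (Strip δ) := by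
  rintro ⟨x, y, t⟩ ht
  have e : ∀ {a : ℝ × ℝ × ℝ → ℝ}, AnalyticOnNhd ℝ a (Strip δ) →
      AnalyticOnNhd ℝ (fun s => a (x, y, s)) (Ioo (-δ) δ) := by
    intro a ha s hs
    have h1 : AnalyticAt ℝ (fun s : ℝ => (x, y, s)) s :=
      analyticAt_const.prod (analyticAt_const.prod analyticAt_id)
    exact (ha (x, y, s) hs).comp_of_eq h1 rfl
  have h0 : (0 : ℝ) ∈ Ioo (-δ) δ := ⟨neg_lt_zero.2 hδ, hδ⟩
  refine (e hh).eqOn_of_preconnected_of_eventuallyEq (e hk) isPreconnected_Ioo h0 ?_ ht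
  have hd := (e hh 0 h0).sub (e hk 0 h0)
  have htop : analyticOrderAt ((fun s => h (x, y, s)) - fun s => k (x, y, s)) 0 = ⊤ := by
    refine ENat.eq_top_iff_forall_ge.2 fun n => ?_
    refine (natCast_le_analyticOrderAt_iff_iteratedDeriv_eq_zero hd).2 fun i hi => ?_
    rw [iteratedDeriv_sub ((e hh 0 h0).contDiffAt) ((e hk 0 h0).contDiffAt),
      (H n).iteratedDeriv_eq hδ hh hk hi, sub_self]
  filter_upwards [analyticOrderAt_eq_top.1 htop] with s hs
  exact sub_eq_zero.1 hs

end AgreeToOrder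

theorem Strip.mono {δ ε : ℝ} (h : δ ≤ ε) : Strip δ ⊆ Strip ε := fun _ hp =>
  ⟨lt_of_le_of_lt (neg_le_neg h) hp.1, lt_of_lt_of_le hp.2 h⟩

theorem IsCauchySolution.eqOn_strip {Λ₁ Λ₂ : ℝ → ℝ} {ε ε' : ℝ} (hδ : 0 < δ) (hε : δ ≤ ε)
    (hε' : δ ≤ ε') {Λ u f g Λ' u' f' g' : ℝ × ℝ × ℝ → ℝ} (S : IsCauchySolution Λ₁ Λ₂ ε Λ u f g)
    (S' : IsCauchySolution Λ₁ Λ₂ ε' Λ' u' f' g') :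
    EqOn Λ Λ' (Strip δ) ∧ EqOn u u' (Strip δ) ∧ EqOn f f' (Strip δ) ∧ EqOn g g' (Strip δ) := by
  obtain ⟨aΛ, au, af, ag, -, -, -, -, hsys, hinit⟩ := S
  obtain ⟨aΛ', au', af', ag', -, -, -, -, hsys', hinit'⟩ := S'
  replace hsys : ∀ p ∈ Strip δ, System11At Λ u f g p := fun p hp => hsys p (Strip.mono hε hp)
  replace hsys' : ∀ p ∈ Strip δ, System11At Λ' u' f' g' p :=
    fun p hp => hsys' p (Strip.mono hε' hp)
  replace aΛ := aΛ.mono (Strip.mono hε)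
  replace au := au.mono (Strip.mono hε)
  replace af := af.mono (Strip.mono hε)
  replace ag := ag.mono (Strip.mono hε)
  replace aΛ' := aΛ'.mono (Strip.mono hε')
  replace au' := au'.mono (Strip.mono hε')
  replace af' := af'.mono (Strip.mono hε')
  replace ag' := ag'.mono (Strip.mono hε')
  have key : ∀ n, AgreeToOrder n Λ Λ' ∧ AgreeToOrder n u u' ∧ AgreeToOrder n f f' ∧
      AgreeToOrder n g g' := by
    intro n
    induction n with
    | zero => exact ⟨trivial, trivial, trivial, trivial⟩
    | succ n ih =>
      obtain ⟨iΛ, iu, jf, ig⟩ := ih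
      let J : (ℝ × ℝ × ℝ → ℝ) → (ℝ × ℝ × ℝ → ℝ) → Prop := fun a a' =>
        AnalyticOnNhd ℝ a (Strip δ) ∧ AnalyticOnNhd ℝ a' (Strip δ) ∧ AgreeToOrder n a a'
      have jadd : ∀ {a a' b b'}, J a a' → J b b' → J (fun p => a p + b p) fun p => a' p + b' p :=
        fun A B => ⟨A.1.add B.1, A.2.1.add B.2.1, A.2.2.add hδ A.1 A.2.1 B.1 B.2.1 B.2.2⟩
      have jmul : ∀ {a a' b b'}, J a a' → J b b' → J (fun p => a p * b p) fun p => a' p * b' p :=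
        fun A B => ⟨A.1.mul B.1, A.2.1.mul B.2.1, A.2.2.mul hδ A.1 A.2.1 B.1 B.2.1 B.2.2⟩
      have const : ∀ c : ℝ, J (fun _ => c) fun _ => c := fun c =>
        ⟨analyticOnNhd_const, analyticOnNhd_const, AgreeToOrder.refl n _⟩
      have dX : ∀ {a a'}, J a a' → J (pX a) (pX a') := fun A =>
        ⟨A.1.fderiv_apply_const _, A.2.1.fderiv_apply_const _, A.2.2.fderiv_apply hδ A.1 A.2.1 1 0⟩
      have dY : ∀ {a a'}, J a a' → J (pY a) (pY a') := fun A =>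
        ⟨A.1.fderiv_apply_const _, A.2.1.fderiv_apply_const _, A.2.2.fderiv_apply hδ A.1 A.2.1 0 1⟩
      have JΛ : J Λ Λ' := ⟨aΛ, aΛ', iΛ⟩
      have Ju : J u u' := ⟨au, au', iu⟩
      have Jf : J f f' := ⟨af, af', jf⟩
      have Jg : J g g' := ⟨ag, ag', ig⟩
      have eΛ := jadd (jadd (jadd (jmul Jg (dX JΛ)) (jmul JΛ (dX Jg))) (jmul Jf (dY JΛ)))
        (jmul JΛ (dY Jf))
      have eu := jadd (jadd (jadd (jadd (jadd (jmul (jmul (const (-2)) Jg) (dX JΛ)) (jmul Jg (dX Ju)))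
        (jmul (jmul (const (-2)) JΛ) (dX Jg))) (jmul (jmul (const 2) Jf) (dY JΛ)))
        (jmul Jf (dY Ju))) (jmul (jmul (const 2) JΛ) (dY Jf))
      have ef := jmul (const 2) (dY Ju)
      have eg := jmul (const (-2)) (dX Ju)
      refine ⟨⟨fun x y => ?_, eΛ.2.2.congr hδ (fun p hp => (hsys p hp).1)
          fun p hp => (hsys' p hp).1⟩,
        ⟨fun x y => ?_, eu.2.2.congr hδ (fun p hp => (hsys p hp).2.1.trans (by ring))
          fun p hp => (hsys' p hp).2.1.trans (by ring)⟩,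
        ⟨fun x y => ?_, ef.2.2.congr hδ (fun p hp => (hsys p hp).2.2.1)
          fun p hp => (hsys' p hp).2.2.1⟩,
        ⟨fun x y => ?_, eg.2.2.congr hδ (fun p hp => (hsys p hp).2.2.2)
          fun p hp => (hsys' p hp).2.2.2⟩⟩
      · rw [(hinit x y).1, (hinit' x y).1]
      · rw [(hinit x y).2.1, (hinit' x y).2.1]
      · rw [(hinit x y).2.2.1, (hinit' x y).2.2.1]
      · rw [(hinit x y).2.2.2, (hinit' x y).2.2.2]
  exact ⟨AgreeToOrder.eqOn_strip hδ aΛ aΛ' fun n => (key n).1,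
    AgreeToOrder.eqOn_strip hδ au au' fun n => (key n).2.1,
    AgreeToOrder.eqOn_strip hδ af af' fun n => (key n).2.2.1,
    AgreeToOrder.eqOn_strip hδ ag ag' fun n => (key n).2.2.2⟩

end Uniqueness

end Preliminaries

/-- For positive analytic `1`-periodic `Λ₁, Λ₂`, the Cauchy problem for
system (11) with Liouville initial data has a real analytic solution, doubly periodic in
`(x,y)`, on some strip `ℝ² × (-ε, ε)`; and any two real analytic solutions of this Cauchy
problem agree on a neighborhood of the plane `{t = 0}`. -/
theorem statement2
    (Λ₁ Λ₂ : ℝ → ℝ)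
    (hΛ₁a : AnalyticOnNhd ℝ Λ₁ univ) (hΛ₂a : AnalyticOnNhd ℝ Λ₂ univ)
    (hΛ₁pos : ∀ x, 0 < Λ₁ x) (hΛ₂pos : ∀ y, 0 < Λ₂ y)
    (hΛ₁per : Function.Periodic Λ₁ 1) (hΛ₂per : Function.Periodic Λ₂ 1) :
    (∃ ε > 0, ∃ Λ u₀ f g : ℝ × ℝ × ℝ → ℝ, IsCauchySolution Λ₁ Λ₂ ε Λ u₀ f g) ∧
    (∀ ε ε' : ℝ, 0 < ε → 0 < ε' →
      ∀ Λ u₀ f g Λ' u₀' f' g' : ℝ × ℝ × ℝ → ℝ,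
        IsCauchySolution Λ₁ Λ₂ ε Λ u₀ f g →
        IsCauchySolution Λ₁ Λ₂ ε' Λ' u₀' f' g' →
        ∃ δ > 0, δ ≤ ε ∧ δ ≤ ε' ∧
          ∀ p ∈ Strip δ, Λ p = Λ' p ∧ u₀ p = u₀' p ∧ f p = f' p ∧ g p = g' p) := by
  refine ⟨exists_isCauchySolution hΛ₁a hΛ₂a hΛ₁per hΛ₂per, ?_⟩
  intro ε ε' hε hε' Λ u₀ f g Λ' u₀' f' g' S S'
  obtain ⟨h1, h2, h3, h4⟩ :=
    S.eqOn_strip (lt_min hε hε') (min_le_left _ _) (min_le_right _ _) S'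
  exact ⟨min ε ε', lt_min hε hε', min_le_left _ _, min_le_right _ _,
    fun p hp => ⟨h1 hp, h2 hp, h3 hp, h4 hp⟩⟩
end

section
/- Let Λ₁, Λ₂: ℝ → ℝ be real analytic, positive, 1-periodic functions, and let Λ, u₀, f, g be the real analytic solution of system (11) on ℝ² × (−ε, ε), doubly periodic in (x,y), with the Liouville initial data. Define Ω(x,y,t) = (1/4)(g_x − f_y). Then ∂Ω/∂t(x,y,0) = Λ₁''(x) − Λ₂''(y) for all (x,y). In particular, if at least one of Λ₁, Λ₂ is nonconstant, then ∂Ω/∂t(·,·,0) is not identically zero, so the magnetic field Ω(·,·,t) is nonzero for all sufficiently small t ≠ 0. -/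
open Set

open Filter Topology

/-- Directional derivatives of an analytic function are analytic. -/
theorem analyticAt_fderiv_apply {E : Type*} [NormedAddCommGroup E] [NormedSpace ℝ E]
    {h : E → ℝ} {p : E} (hh : AnalyticAt ℝ h p) (v : E) :
    AnalyticAt ℝ (fun q => fderiv ℝ h q v) p :=
  ((ContinuousLinearMap.apply ℝ ℝ v).analyticAt _).comp hh.fderiv

/-- Directional derivatives of an analytic function commute. -/
theorem fderiv_fderiv_apply_comm {E : Type*} [NormedAddCommGroup E] [NormedSpace ℝ E]
    {h : E → ℝ} {p : E} (hh : AnalyticAt ℝ h p) (v w : E) :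
    fderiv ℝ (fun q => fderiv ℝ h q v) p w = fderiv ℝ (fun q => fderiv ℝ h q w) p v := by
  have hd : DifferentiableAt ℝ (fderiv ℝ h) p := hh.fderiv.differentiableAt
  have key : ∀ a b : E, fderiv ℝ (fun q => fderiv ℝ h q a) p b = fderiv ℝ (fderiv ℝ h) p b a := by
    intro a b
    rw [fderiv_clm_apply hd (differentiableAt_const a)]
    simp
  have hs : IsSymmSndFDerivAt ℝ h p :=
    (hh.contDiffAt (n := 2)).isSymmSndFDerivAt (by simp)
  rw [key, key, hs.eq]

theorem hasDerivAt_slice_x {h : ℝ × ℝ × ℝ → ℝ} {x y t : ℝ}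
    (hh : DifferentiableAt ℝ h (x, y, t)) :
    HasDerivAt (fun s => h (s, y, t)) (pX h (x, y, t)) x :=
  hh.hasFDerivAt.comp_hasDerivAt x
    ((hasDerivAt_id x).prodMk ((hasDerivAt_const x y).prodMk (hasDerivAt_const x t)))

theorem hasDerivAt_slice_y {h : ℝ × ℝ × ℝ → ℝ} {x y t : ℝ}
    (hh : DifferentiableAt ℝ h (x, y, t)) :
    HasDerivAt (fun s => h (x, s, t)) (pY h (x, y, t)) y :=
  hh.hasFDerivAt.comp_hasDerivAt y
    ((hasDerivAt_const y x).prodMk ((hasDerivAt_id y).prodMk (hasDerivAt_const y t)))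

theorem hasDerivAt_slice_t {h : ℝ × ℝ × ℝ → ℝ} {x y t : ℝ}
    (hh : DifferentiableAt ℝ h (x, y, t)) :
    HasDerivAt (fun s => h (x, y, s)) (pT h (x, y, t)) t :=
  hh.hasFDerivAt.comp_hasDerivAt t
    ((hasDerivAt_const t x).prodMk ((hasDerivAt_const t y).prodMk (hasDerivAt_id t)))

/-- A periodic function with constant derivative is constant. -/
theorem Function.Periodic.eq_of_deriv_eq_const {F : ℝ → ℝ} {c : ℝ}
    (hper : Function.Periodic F 1) (hF : Differentiable ℝ F) (hc : ∀ x, deriv F x = c)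
    (a b : ℝ) : F a = F b := by
  have hG : ∀ x, HasDerivAt (fun s => F s - c * s) 0 x := by
    intro x
    have hd := (hF x).hasDerivAt.fun_sub ((hasDerivAt_id x).const_mul c)
    rwa [hc x, mul_one, sub_self] at hd
  have hconst := is_const_of_deriv_eq_zero (fun x => (hG x).differentiableAt)
    (fun x => (hG x).deriv)
  have h01 := hconst 1 0
  have hp := hper 0
  have hab := hconst a b
  simp only [zero_add] at hp
  have hc0 : c = 0 := by linarith
  simpa [hc0] using hab

/-- A periodic analytic function with constant second derivative is constant. -/
theorem Function.Periodic.eq_of_deriv_deriv_eq_const {F : ℝ → ℝ} {c : ℝ}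
    (hper : Function.Periodic F 1) (hF : AnalyticOnNhd ℝ F univ)
    (hc : ∀ x, deriv (deriv F) x = c) (a b : ℝ) : F a = F b := by
  have hper' : Function.Periodic (deriv F) 1 := by
    intro x
    rw [← deriv_comp_add_const]
    exact congrArg (deriv · x) (funext hper)
  refine hper.eq_of_deriv_eq_const (fun x => (hF x (mem_univ _)).differentiableAt)
    (c := deriv F 0) (fun x => ?_) a b
  exact hper'.eq_of_deriv_eq_const (fun x => (hF x (mem_univ _)).deriv.differentiableAt) hc x 0

theorem strip_mem_nhds {ε : ℝ} {p : ℝ × ℝ × ℝ} (hp : p ∈ Strip ε) : Strip ε ∈ 𝓝 p :=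
  (isOpen_Ioo.preimage (continuous_snd.comp continuous_snd)).mem_nhds hp

/-- For the real analytic solution of system (11) with Liouville initial
data, the magnetic field `Ω = (g_x - f_y)/4` satisfies `∂Ω/∂t(x,y,0) = Λ₁''(x) - Λ₂''(y)`.
In particular, if `Λ₁` or `Λ₂` is nonconstant, then `∂Ω/∂t(·,·,0)` is not identically zero,
and `Ω(·,·,t)` is not identically zero for all sufficiently small `t ≠ 0`. -/
theorem statement7
    (Λ₁ Λ₂ : ℝ → ℝ)
    (hΛ₁a : AnalyticOnNhd ℝ Λ₁ univ) (hΛ₂a : AnalyticOnNhd ℝ Λ₂ univ)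
    (hΛ₁pos : ∀ x, 0 < Λ₁ x) (hΛ₂pos : ∀ y, 0 < Λ₂ y)
    (hΛ₁per : Function.Periodic Λ₁ 1) (hΛ₂per : Function.Periodic Λ₂ 1)
    (ε : ℝ) (hε : 0 < ε)
    (Λ u₀ f g : ℝ × ℝ × ℝ → ℝ)
    (hsol : IsCauchySolution Λ₁ Λ₂ ε Λ u₀ f g)
    (Ω : ℝ × ℝ × ℝ → ℝ)
    (hΩ : ∀ p : ℝ × ℝ × ℝ, Ω p = (1/4) * (pX g p - pY f p)) :
    (∀ x y : ℝ, pT Ω (x, y, 0) = deriv (deriv Λ₁) x - deriv (deriv Λ₂) y) ∧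
    (((∃ a b : ℝ, Λ₁ a ≠ Λ₁ b) ∨ (∃ a b : ℝ, Λ₂ a ≠ Λ₂ b)) →
      (∃ x y : ℝ, pT Ω (x, y, 0) ≠ 0) ∧
      ∃ δ > 0, δ ≤ ε ∧ ∀ t : ℝ, t ≠ 0 → |t| < δ → ∃ x y : ℝ, Ω (x, y, t) ≠ 0) := by
  obtain ⟨-, hu, hf, hg, -, -, -, -, hsys, hinit⟩ := hsol
  have hmem : ∀ x y : ℝ, (x, y, (0 : ℝ)) ∈ Strip ε := fun x y => by
    simp [Strip, hε]
  have hΩeq : Ω = fun p => (1/4) * (pX g p - pY f p) := funext hΩ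
  have hgX : ∀ x y : ℝ, DifferentiableAt ℝ (pX g) (x, y, 0) := fun x y =>
    (analyticAt_fderiv_apply (hg _ (hmem x y)) _).differentiableAt
  have hfY : ∀ x y : ℝ, DifferentiableAt ℝ (pY f) (x, y, 0) := fun x y =>
    (analyticAt_fderiv_apply (hf _ (hmem x y)) _).differentiableAt
  have huX : ∀ x y : ℝ, DifferentiableAt ℝ (pX u₀) (x, y, 0) := fun x y =>
    (analyticAt_fderiv_apply (hu _ (hmem x y)) _).differentiableAt
  have huY : ∀ x y : ℝ, DifferentiableAt ℝ (pY u₀) (x, y, 0) := fun x y =>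
    (analyticAt_fderiv_apply (hu _ (hmem x y)) _).differentiableAt
  have hΩd : ∀ x y : ℝ, DifferentiableAt ℝ Ω (x, y, 0) := fun x y => by
    rw [hΩeq]
    exact ((hgX x y).sub (hfY x y)).const_mul _
  have hpXu : ∀ x y : ℝ, pX u₀ (x, y, 0) = -2 * deriv Λ₁ x := fun x y => by
    have h1 := hasDerivAt_slice_x (hu _ (hmem x y)).differentiableAt
    have h2 : HasDerivAt (fun s => u₀ (s, y, 0)) (-2 * deriv Λ₁ x) x := by
      simp only [(hinit _ _).2.1]
      simpa using ((hΛ₁a x (mem_univ _)).differentiableAt.hasDerivAt.const_mul 2).const_sub (2 * Λ₂ y)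
    exact h1.unique h2
  have hpYu : ∀ x y : ℝ, pY u₀ (x, y, 0) = 2 * deriv Λ₂ y := fun x y => by
    have h1 := hasDerivAt_slice_y (hu _ (hmem x y)).differentiableAt
    have h2 : HasDerivAt (fun s => u₀ (x, s, 0)) (2 * deriv Λ₂ y) y := by
      simp only [(hinit _ _).2.1]
      exact ((hΛ₂a y (mem_univ _)).differentiableAt.hasDerivAt.const_mul 2).sub_const (2 * Λ₁ x)
    exact h1.unique h2
  have hpXXu : ∀ x y : ℝ, pX (pX u₀) (x, y, 0) = -2 * deriv (deriv Λ₁) x := fun x y => by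
    have h1 := hasDerivAt_slice_x (huX x y)
    simp only [hpXu] at h1
    exact h1.unique ((hΛ₁a x (mem_univ _)).deriv.differentiableAt.hasDerivAt.const_mul (-2))
  have hpYYu : ∀ x y : ℝ, pY (pY u₀) (x, y, 0) = 2 * deriv (deriv Λ₂) y := fun x y => by
    have h1 := hasDerivAt_slice_y (huY x y)
    simp only [hpYu] at h1
    exact h1.unique ((hΛ₂a y (mem_univ _)).deriv.differentiableAt.hasDerivAt.const_mul 2)
  have hgTX : ∀ x y : ℝ, pT (pX g) (x, y, 0) = -2 * pX (pX u₀) (x, y, 0) := fun x y => by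
    have hE : pT g =ᶠ[𝓝 (x, y, 0)] fun p => -2 * pX u₀ p := by
      filter_upwards [strip_mem_nhds (hmem x y)] with p hp using (hsys p hp).2.2.2
    calc pT (pX g) (x, y, 0) = fderiv ℝ (pT g) (x, y, 0) (1, 0, 0) :=
          fderiv_fderiv_apply_comm (hg _ (hmem x y)) _ _
      _ = -2 * pX (pX u₀) (x, y, 0) := by
          rw [hE.fderiv_eq, fderiv_const_mul (huX x y)]
          rfl
  have hfTY : ∀ x y : ℝ, pT (pY f) (x, y, 0) = 2 * pY (pY u₀) (x, y, 0) := fun x y => by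
    have hE : pT f =ᶠ[𝓝 (x, y, 0)] fun p => 2 * pY u₀ p := by
      filter_upwards [strip_mem_nhds (hmem x y)] with p hp using (hsys p hp).2.2.1
    calc pT (pY f) (x, y, 0) = fderiv ℝ (pT f) (x, y, 0) (0, 1, 0) :=
          fderiv_fderiv_apply_comm (hf _ (hmem x y)) _ _
      _ = 2 * pY (pY u₀) (x, y, 0) := by
          rw [hE.fderiv_eq, fderiv_const_mul (huY x y)]
          rfl
  have hmain : ∀ x y : ℝ, pT Ω (x, y, 0) = deriv (deriv Λ₁) x - deriv (deriv Λ₂) y := by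
    intro x y
    have h1 : HasDerivAt (fun s => Ω (x, y, s))
        ((1/4) * (pT (pX g) (x, y, 0) - pT (pY f) (x, y, 0))) 0 := by
      simp only [hΩ]
      exact ((hasDerivAt_slice_t (hgX x y)).sub (hasDerivAt_slice_t (hfY x y))).const_mul _
    rw [(hasDerivAt_slice_t (hΩd x y)).unique h1, hgTX, hfTY, hpXXu, hpYYu]
    ring
  refine ⟨hmain, fun hnc => ?_⟩
  have hne : ∃ x y : ℝ, pT Ω (x, y, 0) ≠ 0 := by
    by_contra! hzero
    have heq : ∀ x y : ℝ, deriv (deriv Λ₁) x = deriv (deriv Λ₂) y := fun x y =>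
      sub_eq_zero.1 ((hmain x y).symm.trans (hzero x y))
    rcases hnc with ⟨a, b, hab⟩ | ⟨a, b, hab⟩
    · exact hab (hΛ₁per.eq_of_deriv_deriv_eq_const hΛ₁a (fun x => heq x 0) a b)
    · exact hab (hΛ₂per.eq_of_deriv_deriv_eq_const hΛ₂a (fun y => (heq 0 y).symm) a b)
  refine ⟨hne, ?_⟩
  obtain ⟨x, y, hxy⟩ := hne
  have hev := (hasDerivAt_slice_t (hΩd x y)).eventually_ne hxy (c := 0)
  rw [eventually_nhdsWithin_iff, Metric.eventually_nhds_iff] at hev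
  obtain ⟨δ, hδ, hball⟩ := hev
  refine ⟨min δ ε, lt_min hδ hε, min_le_right _ _, fun t ht htδ => ⟨x, y, ?_⟩⟩
  exact hball (by simpa using htδ.trans_le (min_le_left _ _)) ht
end
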